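/- arXiv:2101.02775 — 3 statements merged into one kernel-verified Lean document; each statement's English description precedes it below -/
import Mathlib

section
/- A function f : ℂ → ℂ analytic on ℂ ∖ [0,∞) belongs to the Stieltjes class 𝔖 if and only if there exist a real number γ ≥ 0 and a positive Borel measure σ on [0,∞) with ∫_{[0,∞)} (1+t)⁻¹ dσ(t) < ∞ such that f(z) = γ + ∫_{[0,∞)} (t − z)⁻¹ dσ(t) for all z ∈ ℂ ∖ [0,∞). -/
open Complex MeasureTheory Polynomial Matrix
open scoped ComplexConjugate

noncomputable section

/-- The cut `[0, ∞)` viewed as a subset of `ℂ`. -/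
def SCut : Set ℂ := {z : ℂ | 0 ≤ z.re ∧ z.im = 0}

/-- The slit domain `ℂ \ [0, ∞)`. -/
def SDom : Set ℂ := {z : ℂ | ¬ (0 ≤ z.re ∧ z.im = 0)}

/-- The Stieltjes class `𝔖`: functions analytic on `ℂ \ [0,∞)` that are either
nonnegative real constants or satisfy (i) `Im f(z) > 0` on the upper half-plane,
(ii) `f(x) > 0` for real `x < 0`, (iii) `conj (f z) = f (conj z)`. -/
def StieltjesClass (f : ℂ → ℂ) : Prop :=
  AnalyticOnNhd ℂ f SDom ∧
  ((∃ c : ℝ, 0 ≤ c ∧ ∀ z ∈ SDom, f z = (c : ℂ)) ∨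
    ((∀ z : ℂ, 0 < z.im → 0 < (f z).im) ∧
     (∀ x : ℝ, x < 0 → ∃ r : ℝ, 0 < r ∧ f (x : ℂ) = (r : ℂ)) ∧
     (∀ z ∈ SDom, conj (f z) = f (conj z))))

/-- `f` has a Stieltjes spectral representation with constant `γ ≥ 0` and positive Borel
measure `σ` supported on `[0,∞)` with `∫ (1+t)⁻¹ dσ < ∞`, namely
`f z = γ + ∫ (t - z)⁻¹ dσ(t)` on `ℂ \ [0,∞)`. -/
def IsStieltjesRep (f : ℂ → ℂ) (γ : ℝ) (σ : Measure ℝ) : Prop :=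
  0 ≤ γ ∧ σ (Set.Iio 0) = 0 ∧
  (∫⁻ t, ENNReal.ofReal ((1 + t)⁻¹) ∂σ) < ⊤ ∧
  ∀ z ∈ SDom, f z = (γ : ℂ) + ∫ t, ((t : ℂ) - z)⁻¹ ∂σ

open Filter Topology

lemma weak_limit (u : ℕ → ℝ → ℝ) (hc : ∀ n, Continuous (u n)) (h0 : ∀ n θ, 0 ≤ u n θ) (K : ℝ)
    (hK : ∀ n, ∫ θ in (0:ℝ)..(2 * Real.pi), u n θ = K) :
    ∃ (μ : Measure ℝ) (F : Ultrafilter ℕ), IsFiniteMeasure μ ∧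
      μ (Set.Icc 0 (2 * Real.pi))ᶜ = 0 ∧ (F : Filter ℕ) ≤ atTop ∧
      ∀ φ : ℝ → ℝ, Continuous φ →
        Tendsto (fun n => ∫ θ in (0:ℝ)..(2 * Real.pi), φ θ * u n θ) F (𝓝 (∫ θ, φ θ ∂μ)) := by
  have hpi : (0:ℝ) ≤ 2 * Real.pi := by positivity
  let E := Set.Icc (0:ℝ) (2 * Real.pi)
  have hE : MeasurableEmbedding (Subtype.val : E → ℝ) :=
    MeasurableEmbedding.subtype_coe measurableSet_Icc
  have hint : ∀ n, ∀ φ : ℝ → ℝ, Continuous φ →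
      ∫ x : E, φ x ∂((volume.withDensity (fun θ => ENNReal.ofReal (u n θ))).comap Subtype.val)
        = ∫ θ in (0:ℝ)..(2 * Real.pi), φ θ * u n θ := by
    intro n φ hφ
    rw [← hE.integral_map (μ := (volume.withDensity (fun θ => ENNReal.ofReal (u n θ))).comap
      Subtype.val) (g := φ), hE.map_comap, Subtype.range_val,
      intervalIntegral.integral_of_le hpi, ← integral_Icc_eq_integral_Ioc]
    rw [setIntegral_withDensity_eq_setIntegral_toReal_smul (by fun_prop) (by simp) _ measurableSet_Icc]
    refine integral_congr_ae (.of_forall fun θ => ?_)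
    simp [ENNReal.toReal_ofReal (h0 n θ), mul_comm]
  have hmass : ∀ n, ((volume.withDensity (fun θ => ENNReal.ofReal (u n θ))).comap Subtype.val)
      (Set.univ : Set E) = ENNReal.ofReal K := by
    intro n
    rw [hE.comap_apply, Set.image_univ, Subtype.range_val, withDensity_apply _ measurableSet_Icc,
      ← ofReal_integral_eq_lintegral_ofReal ((hc n).integrableOn_Icc) (.of_forall (h0 n)),
      integral_Icc_eq_integral_Ioc, ← intervalIntegral.integral_of_le hpi, hK]
  let M : ℕ → FiniteMeasure E := fun n =>
    ⟨(volume.withDensity (fun θ => ENNReal.ofReal (u n θ))).comap Subtype.val,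
      ⟨by rw [hmass]; exact ENNReal.ofReal_lt_top⟩⟩
  have hM : ∀ n, M n ∈ {μ : FiniteMeasure E | μ.mass ≤ K.toNNReal} := by
    intro n
    simp only [Set.mem_ofPred_eq]
    rw [← ENNReal.coe_le_coe, FiniteMeasure.ennreal_mass]
    exact (hmass n).le
  let F : Ultrafilter ℕ := Ultrafilter.of atTop
  have hcomp := isCompact_setOfPred_finiteMeasure_le_of_compactSpace E K.toNNReal
  obtain ⟨m, -, hm⟩ := hcomp.ultrafilter_le_nhds (F.map M)
    (by rw [le_principal_iff]; exact Eventually.of_forall (f := (F : Filter ℕ)) hM)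
  have hm' : Tendsto M F (𝓝 m) := hm
  rw [FiniteMeasure.tendsto_iff_forall_integral_tendsto] at hm'
  refine ⟨(m : Measure E).map Subtype.val, F, inferInstance, ?_, Ultrafilter.of_le _, ?_⟩
  · rw [hE.map_apply]
    convert measure_empty (μ := (m : Measure E))
    ext x
    simp
  · intro φ hφ
    rw [hE.integral_map]
    have := hm' (BoundedContinuousFunction.mkOfCompact ⟨fun x : E => φ x, by fun_prop⟩)
    refine this.congr fun n => ?_
    exact hint n φ hφ

lemma schwarz_disk (h : ℂ → ℂ) (hh : DifferentiableOn ℂ h (Metric.ball 0 1)) (r : ℝ) (hr0 : 0 ≤ r)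
    (hr : r < 1) (w : ℂ) (hw : w ∈ Metric.ball (0:ℂ) 1) :
    h (r * w) = ((h 0).im : ℂ) * I + Real.circleAverage
      (fun ζ => herglotzRieszKernel 0 w ζ • (((h (r * ζ)).re : ℝ) : ℂ)) 0 1 := by
  let g : ℂ → ℂ := fun ζ => h (r * ζ)
  have hmaps : Set.MapsTo (fun ζ : ℂ => (r:ℂ) * ζ) (Metric.closedBall 0 1) (Metric.ball 0 1) := by
    intro ζ hζ
    simp only [Metric.mem_closedBall, dist_zero_right, Metric.mem_ball, norm_mul, norm_real,
      Real.norm_eq_abs, abs_of_nonneg hr0] at *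
    nlinarith [norm_nonneg ζ]
  have hg : DifferentiableOn ℂ g (Metric.closedBall 0 1) := hh.comp (by fun_prop) hmaps
  have hgc : DiffContOnCl ℂ g (Metric.ball 0 1) := by
    apply DifferentiableOn.diffContOnCl
    rwa [closure_ball _ one_ne_zero]
  have hgre : CircleIntegrable (fun ζ => (g ζ).re) 0 1 := by
    apply ContinuousOn.circleIntegrable zero_le_one
    exact (continuous_re.comp_continuousOn hg.continuousOn).mono Metric.sphere_subset_closedBall
  have hgC : CircleIntegrable (fun ζ => (((g ζ).re : ℝ) : ℂ)) 0 1 := by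
    apply ContinuousOn.circleIntegrable zero_le_one
    exact (continuous_ofReal.comp_continuousOn (continuous_re.comp_continuousOn hg.continuousOn)).mono
      Metric.sphere_subset_closedBall
  let G : ℂ → ℂ := fun w => Real.circleAverage
      (fun ζ => herglotzRieszKernel 0 w ζ • (((g ζ).re : ℝ) : ℂ)) 0 1
  have hG : AnalyticOnNhd ℂ G (Metric.ball 0 1) :=
    analyticOnNhd_circleAverage_herglotzRieszKernel_smul hgC
  have hga : AnalyticOnNhd ℂ g (Metric.ball 0 1) :=
    (hg.mono Metric.ball_subset_closedBall).analyticOnNhd Metric.isOpen_ball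
  have hre : ∀ w ∈ Metric.ball (0:ℂ) 1, (g w - G w).re = 0 := by
    intro w hw
    have h1 := re_circleAverage_herglotzRieszKernel_smul hgre hw
    have h2 := hgc.circleAverage_re_herglotzRieszKernel_smul hw
    have hi : CircleIntegrable ((re ∘ herglotzRieszKernel 0 w) • g) 0 1 := by
      apply ContinuousOn.circleIntegrable zero_le_one
      refine ContinuousOn.smul ?_ (hg.continuousOn.mono Metric.sphere_subset_closedBall)
      have := continuousOn_herglotzRieszKernel_sphere hw
      rw [abs_one] at this
      exact continuous_re.comp_continuousOn this
    have h3 : (Real.circleAverage ((re ∘ herglotzRieszKernel 0 w) • g) 0 1).re =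
        Real.circleAverage ((re ∘ herglotzRieszKernel 0 w) • fun ζ => (g ζ).re) 0 1 := by
      have := reCLM.circleAverage_comp_comm hi
      rw [← reCLM_apply, ← this]
      congr 1
      ext ζ
      simp
    rw [sub_re, sub_eq_zero, ← h2, h3]
    exact h1.symm
  have hconst := (hga.sub hG).eq_const_of_re_eq_const (c₀ := 0) hre Metric.isOpen_ball
    (Metric.isConnected_ball one_pos)
  obtain ⟨c, hcc⟩ := hconst
  have e1 := hcc w hw
  have e2 := hcc 0 (Metric.mem_ball_self one_pos : (0:ℂ) ∈ Metric.ball 0 1)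
  have e3 : (G 0).im = 0 := by
    have : G 0 = ((Real.circleAverage (fun ζ => (g ζ).re) 0 1 : ℝ) : ℂ) := by
      have h4 := ofRealCLM.circleAverage_comp_comm hgre
      rw [← ofRealCLM_apply, ← h4]
      refine Real.circleAverage_congr_sphere fun ζ hζ => ?_
      have : ζ ≠ 0 := by
        rintro rfl; simp at hζ
      simp [herglotzRieszKernel_def, this]
    rw [this, ofReal_im]
  have e4 := hre 0 (Metric.mem_ball_self one_pos)
  have e5 : g 0 = h 0 := by simp [g]
  have : c = ((h 0).im : ℂ) * I := by
    apply Complex.ext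
    · rw [← e2]; simpa using e4
    · rw [← e2]; simp [e3, e5]
  rw [← this, ← e1]
  simp [g, G]

lemma herglotz_disk (h : ℂ → ℂ) (hh : DifferentiableOn ℂ h (Metric.ball 0 1))
    (hpos : ∀ w ∈ Metric.ball (0:ℂ) 1, 0 ≤ (h w).re) :
    ∃ (μ : Measure ℝ) (F : Ultrafilter ℕ), IsFiniteMeasure μ ∧
      μ (Set.Icc 0 (2 * Real.pi))ᶜ = 0 ∧ (F : Filter ℕ) ≤ atTop ∧
      (∀ φ : ℝ → ℝ, Continuous φ →
        Tendsto (fun n : ℕ => ∫ θ in (0:ℝ)..(2 * Real.pi), φ θ *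
          ((2 * Real.pi)⁻¹ * (h (((n / (n + 1) : ℝ) : ℂ) * exp (θ * I))).re)) F
          (𝓝 (∫ θ, φ θ ∂μ))) ∧
      ∀ w ∈ Metric.ball (0:ℂ) 1,
        Integrable (fun θ : ℝ => (exp (θ * I) + w) / (exp (θ * I) - w)) μ ∧
        h w = ((h 0).im : ℂ) * I + ∫ θ : ℝ, (exp (θ * I) + w) / (exp (θ * I) - w) ∂μ := by
  let r : ℕ → ℝ := fun n => n / (n + 1)
  have hr0 : ∀ n, 0 ≤ r n := fun n => by positivity
  have hr1 : ∀ n, r n < 1 := fun n => by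
    simp only [r]; rw [div_lt_one (by positivity)]; linarith
  have hrt : Tendsto r atTop (𝓝 1) := tendsto_natCast_div_add_atTop 1
  have hmem : ∀ n, ∀ ζ : ℂ, ‖ζ‖ ≤ 1 → (r n : ℂ) * ζ ∈ Metric.ball (0:ℂ) 1 := by
    intro n ζ hζ
    simp only [Metric.mem_ball, dist_zero_right, norm_mul, norm_real,
      Real.norm_eq_abs, abs_of_nonneg (hr0 n)]
    nlinarith [norm_nonneg ζ, hr0 n, hr1 n]
  have hexp : ∀ θ : ℝ, ‖exp (θ * I)‖ = 1 := fun θ => norm_exp_ofReal_mul_I θ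
  let u : ℕ → ℝ → ℝ := fun n θ => (2 * Real.pi)⁻¹ * (h ((r n : ℂ) * exp (θ * I))).re
  have hcont : ∀ n, Continuous (fun θ : ℝ => h ((r n : ℂ) * exp (θ * I))) := by
    intro n
    exact hh.continuousOn.comp_continuous (by fun_prop) (fun θ => hmem n _ (hexp θ).le)
  have huc : ∀ n, Continuous (u n) := fun n =>
    continuous_const.mul (continuous_re.comp (hcont n))
  have hu0 : ∀ n θ, 0 ≤ u n θ := fun n θ =>
    mul_nonneg (by positivity) (hpos _ (hmem n _ (hexp θ).le))
  have hrep : ∀ n, ∀ w ∈ Metric.ball (0:ℂ) 1, h (r n * w) = ((h 0).im : ℂ) * I +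
      ∫ θ in (0:ℝ)..(2 * Real.pi), ((exp (θ * I) + w) / (exp (θ * I) - w)) * (u n θ : ℂ) := by
    intro n w hw
    rw [schwarz_disk h hh (r n) (hr0 n) (hr1 n) w hw, Real.circleAverage_def]
    congr 1
    rw [← intervalIntegral.integral_smul]
    refine intervalIntegral.integral_congr fun θ _ => ?_
    simp only [herglotzRieszKernel_def, circleMap, u]
    simp
    ring
  have hK : ∀ n, ∫ θ in (0:ℝ)..(2 * Real.pi), u n θ = (h 0).re := by
    intro n
    have := hrep n 0 (Metric.mem_ball_self one_pos)
    simp only [mul_zero, add_zero, sub_zero] at this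
    have h2 : ∀ θ : ℝ, exp (θ * I) / exp (θ * I) * (u n θ : ℂ) = (u n θ : ℂ) := by
      intro θ; rw [div_self (exp_ne_zero _), one_mul]
    simp only [h2] at this
    rw [intervalIntegral.integral_ofReal] at this
    have := congrArg re this
    simpa using this.symm
  obtain ⟨μ, F, hμ, hsupp, hF, hlim⟩ := weak_limit u huc hu0 _ hK
  refine ⟨μ, F, hμ, hsupp, hF, hlim, ?_⟩
  intro w hw
  have hden : ∀ θ : ℝ, exp (θ * I) - w ≠ 0 := by
    intro θ h0
    rw [sub_eq_zero] at h0
    rw [← h0] at hw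
    simp [hexp θ] at hw
  let k : ℝ → ℂ := fun θ => (exp (θ * I) + w) / (exp (θ * I) - w)
  have hk : Continuous k := by
    apply Continuous.div (by fun_prop) (by fun_prop) hden
  have hkb : ∃ B, ∀ θ, ‖k θ‖ ≤ B := by
    refine ⟨2 / (1 - ‖w‖), fun θ => ?_⟩
    have hw' : ‖w‖ < 1 := by simpa using hw
    rw [norm_div]
    have a1 : ‖exp (θ * I) + w‖ ≤ 2 := (norm_add_le _ _).trans (by rw [hexp]; linarith)
    have a2 : 1 - ‖w‖ ≤ ‖exp (θ * I) - w‖ := by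
      have := norm_sub_norm_le (exp (θ * I)) w
      rwa [hexp] at this
    exact div_le_div₀ (by norm_num) a1 (by linarith) a2
  obtain ⟨B, hB⟩ := hkb
  have hki : Integrable k μ := Integrable.of_bound hk.aestronglyMeasurable B (.of_forall hB)
  have hkre := hlim (fun θ => (k θ).re) (continuous_re.comp hk)
  have hkim := hlim (fun θ => (k θ).im) (continuous_im.comp hk)
  have hsum : Tendsto (fun n => ∫ θ in (0:ℝ)..(2 * Real.pi), k θ * (u n θ : ℂ)) F
      (𝓝 (∫ θ, k θ ∂μ)) := by
    have e1 : ∫ θ, k θ ∂μ = ((∫ θ, (k θ).re ∂μ : ℝ) : ℂ) + ((∫ θ, (k θ).im ∂μ : ℝ) : ℂ) * I :=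
      (integral_re_add_im hki).symm
    rw [e1]
    refine (((continuous_ofReal.tendsto _).comp hkre).add
      (((continuous_ofReal.tendsto _).comp hkim).mul_const I)).congr fun n => ?_
    have hii : IntervalIntegrable (fun θ => k θ * (u n θ : ℂ)) volume 0 (2 * Real.pi) :=
      (hk.mul (continuous_ofReal.comp (huc n))).intervalIntegrable _ _
    simp only [Function.comp]
    rw [← intervalIntegral.integral_ofReal, ← intervalIntegral.integral_ofReal,
      ← intervalIntegral.integral_mul_const, ← intervalIntegral.integral_add]
    · refine intervalIntegral.integral_congr fun θ _ => ?_
      conv_rhs => rw [← re_add_im (k θ)]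
      push_cast
      ring
    · exact (continuous_ofReal.comp ((continuous_re.comp hk).mul (huc n))).intervalIntegrable _ _
    · exact ((continuous_ofReal.comp ((continuous_im.comp hk).mul (huc n))).mul
        continuous_const).intervalIntegrable _ _
  have hL : Tendsto (fun n => h (r n * w)) F (𝓝 (h w)) := by
    have hcw : ContinuousAt h w := (hh.differentiableAt (Metric.isOpen_ball.mem_nhds hw)).continuousAt
    have : Tendsto (fun n => (r n : ℂ) * w) F (𝓝 w) := by
      have := (((continuous_ofReal.tendsto 1).comp hrt).mul_const w).mono_left hF
      simpa using this
    exact hcw.tendsto.comp this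
  refine ⟨hki, tendsto_nhds_unique hL ?_⟩
  have := (tendsto_const_nhds (x := ((h 0).im : ℂ) * I)).add hsum
  exact this.congr fun n => (hrep n w hw).symm

lemma cayley_re (w : ℂ) : (I * (1 + w) / (1 - w)).re = -2 * w.im / normSq (1 - w) := by
  rw [div_re]
  simp [normSq_apply]
  ring

lemma cayley_im (w : ℂ) : (I * (1 + w) / (1 - w)).im = (1 - ‖w‖ ^ 2) / normSq (1 - w) := by
  rw [div_im, ← normSq_eq_norm_sq]
  simp [normSq_apply]
  ring

lemma ne_one_normSq_pos {w : ℂ} (hw : w ≠ 1) : 0 < normSq (1 - w) :=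
  normSq_pos.2 (sub_ne_zero.2 hw.symm)

lemma cayley_mem {w : ℂ} (h : 0 < w.im ∨ ‖w‖ < 1) : I * (1 + w) / (1 - w) ∈ SDom := by
  have hw1 : w ≠ 1 := by rintro rfl; simp at h
  have hp := ne_one_normSq_pos hw1
  rintro ⟨h1, h2⟩
  rcases h with h | h
  · rw [cayley_re] at h1
    have : -2 * w.im / normSq (1 - w) < 0 := div_neg_of_neg_of_pos (by linarith) hp
    linarith
  · rw [cayley_im] at h2
    have : 0 < (1 - ‖w‖ ^ 2) / normSq (1 - w) := div_pos (by nlinarith [norm_nonneg w]) hp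
    linarith

lemma exp_eq_cayley (θ : ℝ) (hs : Real.sin (θ / 2) ≠ 0) :
    exp (θ * I) = (((-Real.cos (θ / 2) / Real.sin (θ / 2) : ℝ) : ℂ) - I) /
      (((-Real.cos (θ / 2) / Real.sin (θ / 2) : ℝ) : ℂ) + I) := by
  have e : exp (θ * I) = ((Real.cos (θ / 2) : ℂ) + (Real.sin (θ / 2) : ℂ) * I) ^ 2 := by
    rw [ofReal_cos, ofReal_sin, ← exp_mul_I, ← exp_nat_mul]
    congr 1
    push_cast
    ring
  have hne : (((-Real.cos (θ / 2) / Real.sin (θ / 2) : ℝ) : ℂ) + I) ≠ 0 := by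
    intro h
    have := congrArg im h
    simp only [add_im, ofReal_im, I_im, zero_im] at this
    norm_num at this
  have hs' : (Real.sin (θ / 2) : ℂ) ≠ 0 := by exact_mod_cast hs
  have hcs : (Real.sin (θ / 2) : ℂ) ^ 2 + (Real.cos (θ / 2) : ℂ) ^ 2 = 1 := by
    exact_mod_cast Real.sin_sq_add_cos_sq (θ / 2)
  rw [e, eq_div_iff hne]
  push_cast only [ofReal_div, ofReal_neg]
  generalize (Real.sin (θ / 2) : ℂ) = s at *
  generalize (Real.cos (θ / 2) : ℂ) = c at *
  field_simp
  ring_nf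
  have hI : I ^ 3 = -I := by rw [pow_succ, I_sq]; ring
  simp only [I_sq, hI]
  linear_combination (-c - s * I) * hcs

lemma exp_eq_one_of_half (θ : ℝ) (hs : Real.sin (θ / 2) = 0) : exp (θ * I) = 1 := by
  have e : exp (θ * I) = ((Real.cos (θ / 2) : ℂ) + (Real.sin (θ / 2) : ℂ) * I) ^ 2 := by
    rw [ofReal_cos, ofReal_sin, ← exp_mul_I, ← exp_nat_mul]
    congr 1
    push_cast
    ring
  have hcs := Real.sin_sq_add_cos_sq (θ / 2)
  rw [hs] at hcs
  rw [e, hs]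
  simp only [ofReal_zero, zero_mul, add_zero]
  have : Real.cos (θ / 2) ^ 2 = 1 := by simpa using hcs
  exact_mod_cast this

lemma isOpen_SDom : IsOpen SDom := by
  have : SDomᶜ = {z : ℂ | 0 ≤ z.re} ∩ {z : ℂ | z.im = 0} := by
    ext z; simp [SDom]
  rw [← isClosed_compl_iff, this]
  exact (isClosed_le continuous_const continuous_re).inter
    (isClosed_eq continuous_im continuous_const)

lemma nevanlinna (f : ℂ → ℂ) (hf : AnalyticOnNhd ℂ f SDom)
    (him : ∀ z : ℂ, 0 < z.im → 0 < (f z).im) (hneg : ∀ x : ℝ, x < 0 → (f x).im = 0) :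
    ∃ (a b : ℝ) (ν : Measure ℝ), IsFiniteMeasure ν ∧ 0 ≤ b ∧ ν (Set.Iio 0) = 0 ∧
      ∀ z : ℂ, 0 < z.im → f z = a + b * z + ∫ t : ℝ, (1 + t * z) / (t - z) ∂ν := by
  let c : ℂ → ℂ := fun w => I * (1 + w) / (1 - w)
  let h : ℂ → ℂ := fun w => -I * f (c w)
  have hre : ∀ w, (h w).re = (f (c w)).im := fun w => by simp [h]
  have hdiff : ∀ w : ℂ, 0 < w.im ∨ ‖w‖ < 1 → DifferentiableAt ℂ h w := by
    intro w hw
    have hw1 : w ≠ 1 := by rintro rfl; simp at hw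
    have h1 : DifferentiableAt ℂ f (c w) := (hf _ (cayley_mem hw)).differentiableAt
    have h2 : DifferentiableAt ℂ c w :=
      DifferentiableAt.div (by fun_prop) (by fun_prop) (sub_ne_zero.2 hw1.symm)
    exact (DifferentiableAt.comp w h1 h2).const_mul _
  obtain ⟨μ, F, hμ, -, hF, hlim, hrep⟩ := herglotz_disk h
    (fun w hw => (hdiff w (Or.inr (by simpa using hw))).differentiableWithinAt)
    (fun w hw => by
      have hw' : ‖w‖ < 1 := by simpa using hw
      rw [hre]
      refine (him _ ?_).le
      have hw1 : w ≠ 1 := by rintro rfl; simp at hw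
      rw [cayley_im]
      exact div_pos (by nlinarith [norm_nonneg w]) (ne_one_normSq_pos hw1))
  have hbd : ∀ θ : ℝ, 0 < Real.sin θ → (h (exp (θ * I))).re = 0 := by
    intro θ hθ
    rw [hre]
    have himθ : (exp (θ * I)).im = Real.sin θ := exp_ofReal_mul_I_im θ
    have hw1 : exp (θ * I) ≠ 1 := by
      intro hh; rw [hh] at himθ; simp at himθ; linarith
    have hc : c (exp (θ * I)) = (((c (exp (θ * I))).re : ℝ) : ℂ) := by
      apply Complex.ext
      · simp
      · rw [ofReal_im, cayley_im, norm_exp_ofReal_mul_I]; simp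
    rw [hc]
    apply hneg
    rw [cayley_re, himθ]
    exact div_neg_of_neg_of_pos (by linarith) (ne_one_normSq_pos hw1)
  -- support
  have hsupp1 : ∀ δ : ℝ, 0 < δ → μ {θ | δ < Real.sin θ} = 0 := by
    intro δ hδ
    let φ : ℝ → ℝ := fun θ => max 0 (Real.sin θ - δ)
    have hφc : Continuous φ := by fun_prop
    have hφ0 : ∀ θ, 0 ≤ φ θ := fun θ => le_max_left _ _
    have hφ1 : ∀ θ, φ θ ≤ 1 := fun θ => max_le zero_le_one (by linarith [Real.sin_le_one θ])
    let Kc : Set ℂ := Metric.closedBall 0 1 ∩ {w | δ / 2 ≤ w.im}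
    have hKc : IsCompact Kc :=
      (isCompact_closedBall _ _).inter_right (isClosed_le continuous_const continuous_im)
    have hKcont : ContinuousOn h Kc := fun w hw =>
      (hdiff w (Or.inl (lt_of_lt_of_le (by linarith) hw.2))).continuousAt.continuousWithinAt
    obtain ⟨B, hB⟩ := hKc.exists_bound_of_continuousOn hKcont
    have hrt : Tendsto (fun n : ℕ => (n / (n + 1) : ℝ)) atTop (𝓝 1) :=
      tendsto_natCast_div_add_atTop 1
    have hz : Tendsto (fun n : ℕ => ∫ θ in (0:ℝ)..(2 * Real.pi), φ θ *
          ((2 * Real.pi)⁻¹ * (h (((n / (n + 1) : ℝ) : ℂ) * exp (θ * I))).re)) atTop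
          (𝓝 (∫ θ in (0:ℝ)..(2 * Real.pi), (0:ℝ))) := by
      refine intervalIntegral.tendsto_integral_filter_of_dominated_convergence
        (fun _ => (2 * Real.pi)⁻¹ * |B|) ?_ ?_ ?_ ?_
      · refine .of_forall fun n => ?_
        refine Continuous.aestronglyMeasurable ?_
        refine hφc.mul (continuous_const.mul (continuous_re.comp ?_))
        refine continuous_iff_continuousAt.2 fun θ => ?_
        refine ContinuousAt.comp (f := fun θ : ℝ => ((n / (n + 1) : ℝ) : ℂ) * exp (θ * I)) (g := h)
          (hdiff _ (Or.inr ?_)).continuousAt (by fun_prop)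
        rw [norm_mul, norm_exp_ofReal_mul_I, norm_real, Real.norm_eq_abs,
          abs_of_nonneg (by positivity), mul_one, div_lt_one (by positivity)]
        linarith
      · filter_upwards [eventually_ge_atTop 1] with n hn
        refine .of_forall fun θ _ => ?_
        rw [Real.norm_eq_abs, abs_mul, abs_mul, abs_of_nonneg (hφ0 θ),
          abs_of_nonneg (show 0 ≤ (2 * Real.pi)⁻¹ by positivity)]
        by_cases hs : δ < Real.sin θ
        · have hmem : ((n / (n + 1) : ℝ) : ℂ) * exp (θ * I) ∈ Kc := by
            have hn' : (1:ℝ) ≤ n := by exact_mod_cast hn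
            have hlow : (1:ℝ) / 2 ≤ n / (n + 1) := by
              rw [div_le_div_iff₀ (by norm_num) (by positivity)]; linarith
            constructor
            · rw [mem_closedBall_zero_iff, norm_mul, norm_exp_ofReal_mul_I, norm_real,
                Real.norm_eq_abs, abs_of_nonneg (by positivity), mul_one, div_le_one (by positivity)]
              linarith
            · show δ / 2 ≤ _
              rw [im_ofReal_mul, exp_ofReal_mul_I_im]
              nlinarith
          have h1 := (abs_re_le_norm _).trans (hB _ hmem)
          have h2 := h1.trans (le_abs_self B)
          calc _ ≤ 1 * ((2 * Real.pi)⁻¹ * |B|) := by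
                gcongr
                exact hφ1 θ
            _ = _ := one_mul _
        · have : φ θ = 0 := max_eq_left (by linarith)
          rw [this, zero_mul]
          positivity
      · exact intervalIntegrable_const
      · refine .of_forall fun θ _ => ?_
        by_cases hs : 0 < Real.sin θ
        · have hcont : ContinuousAt h (exp (θ * I)) :=
            (hdiff _ (Or.inl (by rwa [exp_ofReal_mul_I_im]))).continuousAt
          have h1 : Tendsto (fun n : ℕ => ((n / (n + 1) : ℝ) : ℂ) * exp (θ * I)) atTop
              (𝓝 (exp (θ * I))) := by
            have := (((continuous_ofReal.tendsto 1).comp hrt).mul_const (exp (θ * I)))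
            simpa using this
          have h2 := ((continuous_re.tendsto _).comp (hcont.tendsto.comp h1))
          rw [hbd θ hs] at h2
          have h3 := (h2.const_mul ((2 * Real.pi)⁻¹)).const_mul (φ θ)
          simpa using h3
        · have : φ θ = 0 := max_eq_left (by linarith)
          simp [this]
    have hint0 : ∫ θ, φ θ ∂μ = 0 := by
      have := tendsto_nhds_unique (hlim φ hφc) (hz.mono_left hF)
      simpa using this
    have hφi : Integrable φ μ := Integrable.of_bound hφc.aestronglyMeasurable 1
      (.of_forall fun θ => by rw [Real.norm_eq_abs, abs_of_nonneg (hφ0 θ)]; exact hφ1 θ)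
    rw [integral_eq_zero_iff_of_nonneg hφ0 hφi] at hint0
    refine measure_mono_null ?_ (ae_iff.1 hint0)
    intro θ hθ
    have hθ' : δ < Real.sin θ := hθ
    have : 0 < φ θ := lt_max_of_lt_right (by linarith)
    exact this.ne'
  have hsupp : μ {θ | 0 < Real.sin θ} = 0 := by
    have : {θ | 0 < Real.sin θ} = ⋃ k : ℕ, {θ | 1 / ((k:ℝ) + 1) < Real.sin θ} := by
      ext θ
      simp only [Set.mem_ofPred_eq, Set.mem_iUnion]
      constructor
      · exact fun h => exists_nat_one_div_lt h
      · rintro ⟨k, hk⟩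
        exact lt_trans (by positivity) hk
    rw [this, measure_iUnion_null_iff]
    exact fun k => hsupp1 _ (by positivity)
  let T : ℝ → ℝ := fun θ => -Real.cos (θ / 2) / Real.sin (θ / 2)
  have hT : Measurable T := by fun_prop
  let S : Set ℝ := {θ | Real.sin (θ / 2) ≠ 0}
  have hS : MeasurableSet S := by
    have : Measurable fun θ : ℝ => Real.sin (θ / 2) := by fun_prop
    exact (measurableSet_eq_fun this measurable_const).compl
  refine ⟨-(h 0).im, μ.real Sᶜ, (μ.restrict S).map T, inferInstance, measureReal_nonneg, ?_, ?_⟩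
  · rw [Measure.map_apply hT measurableSet_Iio, Measure.restrict_apply (hT measurableSet_Iio)]
    refine measure_mono_null ?_ hsupp
    rintro θ ⟨h1, h2⟩
    have h1' : -Real.cos (θ / 2) / Real.sin (θ / 2) < 0 := h1
    show 0 < Real.sin θ
    have e : Real.sin θ = 2 * Real.sin (θ / 2) * Real.cos (θ / 2) := by
      rw [← Real.sin_two_mul]; congr 1; ring
    have h2' : Real.sin (θ / 2) ≠ 0 := h2
    have : Real.sin θ = -2 * Real.sin (θ / 2) ^ 2 * (-Real.cos (θ / 2) / Real.sin (θ / 2)) := by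
      rw [e]; field_simp
    rw [this]
    have : 0 < Real.sin (θ / 2) ^ 2 := by positivity
    nlinarith
  · intro z hz
    have hzI : z + I ≠ 0 := by
      intro h0
      have := congrArg im h0
      simp at this
      linarith
    let w : ℂ := (z - I) / (z + I)
    have hcw : c w = z := by
      have : 1 - w = 2 * I / (z + I) := by simp only [w]; field_simp; ring
      simp only [c]
      rw [this]
      simp only [w]
      have := I_ne_zero
      field_simp
      ring
    have hw : w ∈ Metric.ball (0:ℂ) 1 := by
      rw [mem_ball_zero_iff, norm_div, div_lt_one (norm_pos_iff.2 hzI)]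
      apply lt_of_pow_lt_pow_left₀ 2 (norm_nonneg _)
      rw [← normSq_eq_norm_sq, ← normSq_eq_norm_sq, normSq_apply, normSq_apply]
      simp
      nlinarith
    obtain ⟨hki, hk⟩ := hrep w hw
    have hfz : f z = I * h w := by
      simp only [h, hcw]
      rw [← mul_assoc]; simp
    have hTz : ∀ θ, (T θ : ℂ) - z ≠ 0 := by
      intro θ h0
      have := congrArg im h0
      simp at this
      linarith
    have hTI : ∀ θ, (T θ : ℂ) + I ≠ 0 := by
      intro θ h0
      have := congrArg im h0
      simp at this
    have e1 : ∫ θ in S, I * ((exp (θ * I) + w) / (exp (θ * I) - w)) ∂μ =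
        ∫ t : ℝ, (1 + t * z) / (t - z) ∂((μ.restrict S).map T) := by
      rw [integral_map hT.aemeasurable]
      · refine setIntegral_congr_fun hS fun θ hθ => ?_
        have e := exp_eq_cayley θ hθ
        change exp (θ * I) = ((T θ : ℂ) - I) / ((T θ : ℂ) + I) at e
        simp only [e, w]
        have a1 := hTz θ
        have a2 := hTI θ
        have num : ((T θ : ℂ) - I) / ((T θ : ℂ) + I) + (z - I) / (z + I) =
          2 * (1 + T θ * z) / (((T θ : ℂ) + I) * (z + I)) := by
          field_simp
          ring_nf
          rw [I_sq]; ring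
        have den : ((T θ : ℂ) - I) / ((T θ : ℂ) + I) - (z - I) / (z + I) =
          2 * I * (T θ - z) / (((T θ : ℂ) + I) * (z + I)) := by
          field_simp
          ring
        rw [num, den]
        have := I_ne_zero
        field_simp
      · apply Measurable.aestronglyMeasurable
        fun_prop
    have e2 : ∫ θ in Sᶜ, I * ((exp (θ * I) + w) / (exp (θ * I) - w)) ∂μ = μ.real Sᶜ * z := by
      have : ∫ θ in Sᶜ, I * ((exp (θ * I) + w) / (exp (θ * I) - w)) ∂μ = ∫ θ in Sᶜ, z ∂μ := by
        refine setIntegral_congr_fun hS.compl fun θ hθ => ?_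
        have hθ' : Real.sin (θ / 2) = 0 := by simpa [S] using hθ
        simp only [exp_eq_one_of_half θ hθ']
        rw [← mul_div_assoc]
        exact hcw
      rw [this, setIntegral_const]
      simp
    rw [hfz, hk, mul_add, ← integral_const_mul, ← integral_add_compl hS (hki.const_mul I), e1, e2]
    have : I * (((h 0).im : ℂ) * I) = -((h 0).im : ℂ) := by
      rw [mul_comm, mul_assoc, I_mul_I]; ring
    rw [this]
    push_cast
    ring

lemma stieltjes_forward (f : ℂ → ℂ) (hf : AnalyticOnNhd ℂ f SDom)
    (him : ∀ z : ℂ, 0 < z.im → 0 < (f z).im)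
    (hneg : ∀ x : ℝ, x < 0 → ∃ r : ℝ, 0 < r ∧ f (x : ℂ) = (r : ℂ))
    (hconj : ∀ z ∈ SDom, conj (f z) = f (conj z)) :
    ∃ (γ : ℝ) (σ : Measure ℝ), IsStieltjesRep f γ σ := by
  obtain ⟨a, b, ν, hν, hb, hsupp, hrep⟩ := nevanlinna f hf him (fun x hx => by
    obtain ⟨r, -, hr⟩ := hneg x hx
    rw [hr, ofReal_im])
  have hae : ∀ᵐ t ∂ν, 0 ≤ t := by
    rw [ae_iff]; simpa [Set.Iio] using hsupp
  -- alternative form of the kernel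
  have hker : ∀ z : ℂ, ∀ t : ℝ, (t : ℂ) - z ≠ 0 →
      (1 + t * z) / (t - z) = z + (1 + z ^ 2) * ((t : ℂ) - z)⁻¹ := by
    intro z t h
    field_simp
    ring
  have hmeas : ∀ z : ℂ, Measurable fun t : ℝ => ((t : ℂ) - z)⁻¹ := by
    intro z; fun_prop
  -- formula on the negative axis
  have hrepx : ∀ x : ℝ, x < 0 → f x = a + b * x + ∫ t : ℝ, (1 + t * (x:ℂ)) / (t - (x:ℂ)) ∂ν := by
    intro x hx
    have hxS : (x : ℂ) ∈ SDom := by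
      rintro ⟨h1, -⟩
      rw [ofReal_re] at h1; linarith
    let zn : ℕ → ℂ := fun n => x + ((1 / ((n:ℝ) + 1) : ℝ) : ℂ) * I
    have hznre : ∀ n, (zn n).re = x := by
      intro n
      simp only [zn, add_re, ofReal_re, re_ofReal_mul, I_re]
      ring
    have hznim : ∀ n, (zn n).im = 1 / ((n:ℝ) + 1) := fun n => by
      simp only [zn, add_im, ofReal_im, im_ofReal_mul, I_im]; ring
    have hzn : Tendsto zn atTop (𝓝 (x:ℂ)) := by
      have := (((continuous_ofReal.tendsto 0).comp
        (tendsto_one_div_add_atTop_nhds_zero_nat (𝕜 := ℝ))).mul_const I).const_add (x:ℂ)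
      simpa [zn, Function.comp_def] using this
    have hbound : ∀ z : ℂ, z.re = x → ∀ t : ℝ, 0 ≤ t → ‖((t : ℂ) - z)⁻¹‖ ≤ (-x)⁻¹ := by
      intro z hz t ht
      rw [norm_inv]
      apply inv_anti₀ (by linarith)
      have := abs_re_le_norm ((t : ℂ) - z)
      rw [sub_re, ofReal_re, hz, abs_of_nonneg (by linarith)] at this
      linarith
    have hne : ∀ z : ℂ, z.re = x → ∀ t : ℝ, 0 ≤ t → (t : ℂ) - z ≠ 0 := by
      intro z hz t ht h0
      have := congrArg re h0
      simp [hz] at this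
      linarith
    have hform : ∀ z : ℂ, z.re = x → ∫ t : ℝ, (1 + t * z) / (t - z) ∂ν =
        ν.real Set.univ * z + (1 + z ^ 2) * ∫ t : ℝ, ((t : ℂ) - z)⁻¹ ∂ν := by
      intro z hz
      have hi : Integrable (fun t : ℝ => ((t : ℂ) - z)⁻¹) ν :=
        Integrable.of_bound (hmeas z).aestronglyMeasurable (-x)⁻¹
          (hae.mono fun t ht => hbound z hz t ht)
      rw [integral_congr_ae (g := fun t : ℝ => z + (1 + z ^ 2) * ((t : ℂ) - z)⁻¹)
        (hae.mono fun t ht => hker z t (hne z hz t ht)),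
        integral_add (integrable_const _) (hi.const_mul _), integral_const, integral_const_mul]
      simp
    have hlim : Tendsto (fun n => ∫ t : ℝ, ((t : ℂ) - zn n)⁻¹ ∂ν) atTop
        (𝓝 (∫ t : ℝ, ((t : ℂ) - x)⁻¹ ∂ν)) := by
      refine tendsto_integral_of_dominated_convergence (fun _ => (-x)⁻¹)
        (fun n => (hmeas _).aestronglyMeasurable) (integrable_const _)
        (fun n => hae.mono fun t ht => hbound _ (hznre n) t ht) ?_
      refine hae.mono fun t ht => ?_
      exact (tendsto_const_nhds.sub hzn).inv₀ (hne x (ofReal_re x) t ht)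
    have hcont : Tendsto (fun n => f (zn n)) atTop (𝓝 (f x)) :=
      (hf _ hxS).continuousAt.tendsto.comp hzn
    refine tendsto_nhds_unique hcont ?_
    rw [hform x (ofReal_re x)]
    have := ((hzn.const_mul (b:ℂ)).const_add (a:ℂ)).add
      ((hzn.const_mul ((ν.real Set.univ : ℝ) : ℂ)).add (((hzn.pow 2).const_add 1).mul hlim))
    refine this.congr fun n => ?_
    rw [hrep (zn n) (by rw [hznim]; positivity), hform _ (hznre n)]
  -- real inequality
  let N := ν.real Set.univ
  have hineq : ∀ x : ℝ, 1 ≤ x → b * x + ∫ t, t * x / (t + x) ∂ν ≤ a + N / x := by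
    intro x hx
    obtain ⟨r, hr, hfr⟩ := hneg (-x) (by linarith)
    have h1 := hrepx (-x) (by linarith)
    have hi1 : Integrable (fun t : ℝ => t * x / (t + x)) ν := by
      refine Integrable.of_bound (by apply Measurable.aestronglyMeasurable; fun_prop) x (hae.mono fun t ht => ?_)
      rw [Real.norm_eq_abs, abs_of_nonneg (by positivity), div_le_iff₀ (by linarith)]
      nlinarith
    have hi2 : Integrable (fun t : ℝ => (t + x)⁻¹) ν := by
      refine Integrable.of_bound (by fun_prop) 1 (hae.mono fun t ht => ?_)
      rw [Real.norm_eq_abs, abs_of_nonneg (by positivity)]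
      exact inv_le_one_of_one_le₀ (by linarith)
    have h2 : ∫ t : ℝ, (1 + t * ((-x : ℝ) : ℂ)) / (t - ((-x : ℝ) : ℂ)) ∂ν =
        ((∫ t, ((t + x)⁻¹ - t * x / (t + x)) ∂ν : ℝ) : ℂ) := by
      rw [← integral_complex_ofReal]
      refine integral_congr_ae (hae.mono fun t ht => ?_)
      have : (1 + t * ((-x : ℝ) : ℂ)) / (t - ((-x : ℝ) : ℂ)) =
          (((1 + t * (-x)) / (t - (-x)) : ℝ) : ℂ) := by push_cast; rfl
      simp only [this]
      congr 1
      have : t + x ≠ 0 := by linarith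
      rw [sub_neg_eq_add]
      field_simp
      ring
    rw [h2, hfr, integral_sub hi2 hi1] at h1
    have h3 : r = a + b * (-x) + (∫ t, (t + x)⁻¹ ∂ν - ∫ t, t * x / (t + x) ∂ν) := by
      exact_mod_cast h1
    have h4 : ∫ t, (t + x)⁻¹ ∂ν ≤ N / x := by
      have : ∫ t, (t + x)⁻¹ ∂ν ≤ ∫ t, x⁻¹ ∂ν := by
        refine integral_mono_ae hi2 (integrable_const _) (hae.mono fun t ht => ?_)
        exact inv_anti₀ (by linarith) (by linarith)
      rw [integral_const] at this
      simpa [N, div_eq_mul_inv] using this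
    linarith
  have hnn : ∀ x : ℝ, 1 ≤ x → 0 ≤ ∫ t, t * x / (t + x) ∂ν := fun x hx =>
    integral_nonneg_of_ae (hae.mono fun t ht => by
      show 0 ≤ t * x / (t + x)
      positivity)
  have hN : 0 ≤ N := measureReal_nonneg
  have hb0 : b = 0 := by
    by_contra hb'
    have hbp : 0 < b := lt_of_le_of_ne hb (Ne.symm hb')
    let x := max 1 ((a + N + 1) / b)
    have hx1 : 1 ≤ x := le_max_left _ _
    have hx2 : (a + N + 1) / b ≤ x := le_max_right _ _
    rw [div_le_iff₀ hbp] at hx2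
    have := hineq x hx1
    have h2 := hnn x hx1
    have h3 : N / x ≤ N := div_le_self hN hx1
    nlinarith
  subst hb0
  have hNlim : Tendsto (fun n : ℕ => a + N / ((n:ℝ) + 1)) atTop (𝓝 a) := by
    have := ((tendsto_one_div_add_atTop_nhds_zero_nat (𝕜 := ℝ)).const_mul N).const_add a
    simpa [div_eq_mul_inv] using this
  have hfatou : ∫⁻ t, ENNReal.ofReal t ∂ν ≤ ENNReal.ofReal a := by
    have key : ∀ n : ℕ, ∫⁻ t, ENNReal.ofReal (t * ((n:ℝ) + 1) / (t + ((n:ℝ) + 1))) ∂ν ≤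
        ENNReal.ofReal (a + N / ((n:ℝ) + 1)) := by
      intro n
      have hx : (1:ℝ) ≤ (n:ℝ) + 1 := by linarith [Nat.cast_nonneg (α := ℝ) n]
      rw [← ofReal_integral_eq_lintegral_ofReal]
      · apply ENNReal.ofReal_le_ofReal
        have := hineq _ hx
        linarith
      · refine Integrable.of_bound (by apply Measurable.aestronglyMeasurable; fun_prop) ((n:ℝ) + 1)
          (hae.mono fun t ht => ?_)
        rw [Real.norm_eq_abs, abs_of_nonneg (by positivity), div_le_iff₀ (by linarith)]
        nlinarith
      · exact hae.mono fun t ht => by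
          show 0 ≤ t * ((n:ℝ) + 1) / (t + ((n:ℝ) + 1))
          positivity
    have hlimt : ∀ᵐ t ∂ν, Tendsto (fun n : ℕ =>
        ENNReal.ofReal (t * ((n:ℝ) + 1) / (t + ((n:ℝ) + 1)))) atTop (𝓝 (ENNReal.ofReal t)) := by
      refine hae.mono fun t ht => (ENNReal.continuous_ofReal.tendsto _).comp ?_
      have h1 : Tendsto (fun n : ℕ => t / (t * (1 / ((n:ℝ) + 1)) + 1)) atTop
          (𝓝 (t / (t * 0 + 1))) :=
        tendsto_const_nhds.div (((tendsto_one_div_add_atTop_nhds_zero_nat (𝕜 := ℝ)).const_mul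
          t).add_const 1) (by simp)
      simp only [mul_zero, zero_add, div_one] at h1
      refine h1.congr fun n => ?_
      have : (n:ℝ) + 1 ≠ 0 := by positivity
      have : t + ((n:ℝ) + 1) ≠ 0 := by positivity
      field_simp
    calc ∫⁻ t, ENNReal.ofReal t ∂ν
        = ∫⁻ t, liminf (fun n : ℕ =>
            ENNReal.ofReal (t * ((n:ℝ) + 1) / (t + ((n:ℝ) + 1)))) atTop ∂ν :=
          lintegral_congr_ae (hlimt.mono fun t ht => ht.liminf_eq.symm)
      _ ≤ liminf (fun n : ℕ => ∫⁻ t,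
            ENNReal.ofReal (t * ((n:ℝ) + 1) / (t + ((n:ℝ) + 1))) ∂ν) atTop :=
          lintegral_liminf_le (fun n => by fun_prop)
      _ ≤ liminf (fun n : ℕ => ENNReal.ofReal (a + N / ((n:ℝ) + 1))) atTop :=
          liminf_le_liminf (.of_forall key)
      _ = ENNReal.ofReal a := ((ENNReal.continuous_ofReal.tendsto _).comp hNlim).liminf_eq
  have ha : 0 ≤ a := by
    refine ge_of_tendsto' hNlim fun n => ?_
    have hx : (1:ℝ) ≤ (n:ℝ) + 1 := by linarith [Nat.cast_nonneg (α := ℝ) n]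
    have h1 := hineq _ hx
    have h2 := hnn _ hx
    linarith
  have hti : Integrable (fun t : ℝ => t) ν := by
    refine ⟨by fun_prop, ?_⟩
    rw [hasFiniteIntegral_iff_ofReal hae]
    exact hfatou.trans_lt ENNReal.ofReal_lt_top
  have hta : ∫ t, t ∂ν ≤ a := by
    rw [integral_eq_lintegral_of_nonneg_ae hae (by fun_prop)]
    exact ENNReal.toReal_le_of_le_ofReal ha hfatou
  let d : ℝ → ENNReal := fun t => ENNReal.ofReal (1 + t ^ 2)
  have hd : Measurable d := by fun_prop
  have hlt : ∀ᵐ t ∂ν, d t < ⊤ := .of_forall fun t => ENNReal.ofReal_lt_top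
  have hmain : ∀ z : ℂ, (0 < z.im ∨ (z.im = 0 ∧ z.re < 0)) →
      f z = ((a - ∫ t, t ∂ν : ℝ) : ℂ) + ∫ t : ℝ, ((t : ℂ) - z)⁻¹ ∂(ν.withDensity d) := by
    intro z hz
    have h1 : f z = a + ∫ t : ℝ, (1 + t * z) / (t - z) ∂ν := by
      rcases hz with hz | ⟨hz, hz'⟩
      · rw [hrep z hz]; simp
      · have : z = ((z.re : ℝ) : ℂ) := by apply Complex.ext <;> simp [hz]
        rw [this, hrepx _ hz']; simp
    have hne : ∀ t : ℝ, 0 ≤ t → (t : ℂ) - z ≠ 0 := by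
      intro t ht h0
      have e1 := congrArg re h0
      have e2 := congrArg im h0
      simp at e1 e2
      rcases hz with hz | ⟨hz, hz'⟩
      · exact hz.ne' e2
      · linarith
    have hδ : ∃ δ : ℝ, 0 < δ ∧ ∀ t : ℝ, 0 ≤ t → δ ≤ ‖(t : ℂ) - z‖ := by
      rcases hz with hz | ⟨hz, hz'⟩
      · refine ⟨z.im, hz, fun t ht => ?_⟩
        have := abs_im_le_norm ((t : ℂ) - z)
        rw [sub_im, ofReal_im, zero_sub, abs_neg, abs_of_pos hz] at this
        exact this
      · refine ⟨-z.re, by linarith, fun t ht => ?_⟩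
        have := abs_re_le_norm ((t : ℂ) - z)
        rw [sub_re, ofReal_re, abs_of_nonneg (by linarith)] at this
        linarith
    obtain ⟨δ, hδ0, hδ⟩ := hδ
    have hinv : Integrable (fun t : ℝ => ((t : ℂ) - z)⁻¹) ν := by
      refine Integrable.of_bound (hmeas z).aestronglyMeasurable δ⁻¹ (hae.mono fun t ht => ?_)
      rw [norm_inv]
      exact inv_anti₀ hδ0 (hδ t ht)
    have hFi : Integrable (fun t : ℝ => (1 + t * z) / (t - z)) ν := by
      refine (((integrable_const z).add (hinv.const_mul (1 + z ^ 2)))).congr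
        (hae.mono fun t ht => ?_)
      exact (hker z t (hne t ht)).symm
    rw [h1, integral_withDensity_eq_integral_toReal_smul hd hlt]
    have e : ∫ t : ℝ, (d t).toReal • ((t : ℂ) - z)⁻¹ ∂ν =
        ∫ t : ℝ, ((t : ℂ) + (1 + t * z) / (t - z)) ∂ν := by
      refine integral_congr_ae (hae.mono fun t ht => ?_)
      have h2 := hne t ht
      simp only [d]
      rw [ENNReal.toReal_ofReal (by positivity), real_smul]
      push_cast
      field_simp
      ring
    have hti' : Integrable (fun t : ℝ => (t : ℂ)) ν := hti.ofReal
    rw [e, integral_add hti' hFi, integral_complex_ofReal]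
    push_cast
    ring
  refine ⟨a - ∫ t, t ∂ν, ν.withDensity d, by linarith, ?_, ?_, ?_⟩
  · exact withDensity_absolutelyContinuous _ _ hsupp
  · rw [lintegral_withDensity_eq_lintegral_mul _ hd (by fun_prop)]
    have h1 : Integrable (fun t : ℝ => 1 + t) ν := (integrable_const _).add hti
    have h2 := h1.lintegral_lt_top
    refine lt_of_le_of_lt (lintegral_mono_ae (hae.mono fun t ht => ?_)) h2
    simp only [Pi.mul_apply, d]
    rw [← ENNReal.ofReal_mul (by positivity)]
    apply ENNReal.ofReal_le_ofReal
    rw [← div_eq_mul_inv, div_le_iff₀ (by linarith)]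
    nlinarith
  · intro z hz
    have hz' : ¬ (0 ≤ z.re ∧ z.im = 0) := hz
    rcases lt_trichotomy z.im 0 with h | h | h
    · have h1 := hmain (conj z) (Or.inl (by simpa using h))
      have h2 := hconj z hz
      rw [← conj_conj (f z), h2, h1, map_add, conj_ofReal, ← integral_conj]
      congr 1
      refine integral_congr_ae (.of_forall fun t => ?_)
      simp
    · exact hmain z (Or.inr ⟨h, by by_contra hc; exact hz' ⟨by linarith, h⟩⟩)
    · exact hmain z (Or.inl h)

lemma stieltjes_backward (f : ℂ → ℂ) (hf : AnalyticOnNhd ℂ f SDom) (γ : ℝ) (σ : Measure ℝ)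
    (h : IsStieltjesRep f γ σ) : StieltjesClass f := by
  obtain ⟨hγ, hsupp, hfin, hrep⟩ := h
  refine ⟨hf, ?_⟩
  by_cases hσ : σ = 0
  · left
    refine ⟨γ, hγ, fun z hz => ?_⟩
    rw [hrep z hz, hσ]; simp
  right
  have hae : ∀ᵐ t ∂σ, 0 ≤ t := by
    rw [ae_iff]; simpa [Set.Iio] using hsupp
  have hσu : 0 < σ Set.univ := by
    rw [pos_iff_ne_zero]; simpa using hσ
  have hi0 : Integrable (fun t : ℝ => (1 + t)⁻¹) σ := by
    refine ⟨by fun_prop, ?_⟩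
    rw [hasFiniteIntegral_iff_ofReal (hae.mono fun t ht => by
      show 0 ≤ (1 + t)⁻¹
      positivity)]
    exact hfin
  have hδ : ∀ z ∈ SDom, ∃ δ : ℝ, 0 < δ ∧ ∀ t : ℝ, 0 ≤ t → δ ≤ ‖(t : ℂ) - z‖ := by
    intro z hz
    have hz' : ¬ (0 ≤ z.re ∧ z.im = 0) := hz
    by_cases h : z.im = 0
    · have hre : z.re < 0 := by by_contra hc; exact hz' ⟨by linarith, h⟩
      refine ⟨-z.re, by linarith, fun t ht => ?_⟩
      have := abs_re_le_norm ((t : ℂ) - z)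
      rw [sub_re, ofReal_re, abs_of_nonneg (by linarith)] at this
      linarith
    · refine ⟨|z.im|, abs_pos.2 h, fun t ht => ?_⟩
      have := abs_im_le_norm ((t : ℂ) - z)
      rwa [sub_im, ofReal_im, zero_sub, abs_neg] at this
  have hint : ∀ z ∈ SDom, Integrable (fun t : ℝ => ((t : ℂ) - z)⁻¹) σ := by
    intro z hz
    obtain ⟨δ, hδ0, hδ⟩ := hδ z hz
    refine Integrable.mono' (hi0.const_mul (1 + ‖1 + z‖ / δ))
      (by apply Measurable.aestronglyMeasurable; fun_prop) (hae.mono fun t ht => ?_)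
    have h1 := hδ t ht
    have hp : 0 < ‖(t : ℂ) - z‖ := by linarith
    rw [norm_inv, ← div_eq_mul_inv, inv_eq_one_div, div_le_div_iff₀ hp (by linarith), one_mul]
    have h2 : 1 + t ≤ ‖(t : ℂ) - z‖ + ‖1 + z‖ := by
      have h3 := norm_add_le ((t : ℂ) - z) (1 + z)
      have h4 : (t : ℂ) - z + (1 + z) = ((1 + t : ℝ) : ℂ) := by push_cast; ring
      rw [h4, norm_real, Real.norm_eq_abs, abs_of_nonneg (by linarith)] at h3
      exact h3
    have h5 : ‖1 + z‖ ≤ ‖1 + z‖ / δ * ‖(t : ℂ) - z‖ := by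
      rw [div_mul_eq_mul_div, le_div_iff₀ hδ0]
      gcongr
    linarith
  refine ⟨?_, ?_, ?_⟩
  · intro z hz
    have hzS : z ∈ SDom := fun h => hz.ne' h.2
    have hi := hint z hzS
    rw [hrep z hzS, add_im, ofReal_im, zero_add]
    have e : (∫ t : ℝ, ((t : ℂ) - z)⁻¹ ∂σ).im = ∫ t : ℝ, (((t : ℂ) - z)⁻¹).im ∂σ :=
      (integral_im hi).symm
    have hpos : ∀ t : ℝ, 0 < (((t : ℂ) - z)⁻¹).im := by
      intro t
      rw [inv_im]
      have hne : (t : ℂ) - z ≠ 0 := by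
        intro h0
        have := congrArg im h0
        simp at this
        linarith
      apply div_pos _ (normSq_pos.2 hne)
      simpa using hz
    rw [e, integral_pos_iff_support_of_nonneg (fun t => (hpos t).le) hi.im]
    have : Function.support (fun t : ℝ => (((t : ℂ) - z)⁻¹).im) = Set.univ := by
      ext t; simpa using (hpos t).ne'
    rwa [this]
  · intro x hx
    have hxS : (x : ℂ) ∈ SDom := by
      rintro ⟨h1, -⟩
      rw [ofReal_re] at h1; linarith
    have hi := hint x hxS
    have e0 : ∀ t : ℝ, ((t : ℂ) - x)⁻¹ = (((t - x)⁻¹ : ℝ) : ℂ) := fun t => by push_cast; rfl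
    have hi' : Integrable (fun t : ℝ => (t - x)⁻¹) σ := by
      have := hi.re
      refine this.congr (.of_forall fun t => ?_)
      simp only [e0]; exact ofReal_re _
    refine ⟨γ + ∫ t, (t - x)⁻¹ ∂σ, ?_, ?_⟩
    · have : 0 < ∫ t, (t - x)⁻¹ ∂σ := by
        rw [integral_pos_iff_support_of_nonneg_ae (hae.mono fun t ht =>
          inv_nonneg.2 (by linarith : 0 ≤ t - x)) hi']
        refine lt_of_lt_of_le hσu ?_
        rw [← measure_add_measure_compl (measurableSet_Iio (a := (0:ℝ))), hsupp, zero_add]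
        refine measure_mono fun t ht => ?_
        have ht' : 0 ≤ t := by simpa using ht
        exact (inv_pos.2 (by linarith : 0 < t - x)).ne'
      linarith
    · rw [hrep _ hxS]
      simp only [e0]
      rw [integral_complex_ofReal]
      push_cast
      rfl
  · intro z hz
    have hzc : conj z ∈ SDom := by
      intro h
      refine hz ?_
      simpa using h
    rw [hrep z hz, hrep _ hzc, map_add, conj_ofReal, ← integral_conj]
    congr 1
    refine integral_congr_ae (.of_forall fun t => ?_)
    simp

theorem statement2 (f : ℂ → ℂ) (hf : AnalyticOnNhd ℂ f SDom) :
    StieltjesClass f ↔ ∃ (γ : ℝ) (σ : Measure ℝ), IsStieltjesRep f γ σ := by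
  constructor
  · rintro ⟨-, ⟨c, hc, hfc⟩ | ⟨h1, h2, h3⟩⟩
    · refine ⟨c, 0, hc, by simp, by simp, fun z hz => ?_⟩
      rw [hfc z hz]; simp
    · exact stieltjes_forward f hf h1 h2 h3
  · rintro ⟨γ, σ, h⟩
    exact stieltjes_backward f hf γ σ h
end
end

section
/- Let z₁,…,zₙ be pairwise distinct points of the open upper half-plane ℍ₊ and let w ∈ ℂⁿ. There exists a function f in the Stieltjes class 𝔖 with f(z_j) = w_j for all j = 1,…,n if and only if both Nevanlinna–Pick matrices N(z,w) and P(z,w) are positive semidefinite Hermitian matrices. -/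
open Complex MeasureTheory Polynomial Matrix
open scoped ComplexConjugate ComplexOrder

noncomputable section

/-- The Nevanlinna–Pick matrix `N(z,w)` with entries `(w j - conj (w k))/(z j - conj (z k))`. -/
def NPmatN (n : ℕ) (z w : Fin n → ℂ) : Matrix (Fin n) (Fin n) ℂ :=
  Matrix.of fun j k => (w j - conj (w k)) / (z j - conj (z k))

/-- The Nevanlinna–Pick matrix `P(z,w)` with entries
`(z j * w j - conj (z k * w k))/(z j - conj (z k))`. -/
def NPmatP (n : ℕ) (z w : Fin n → ℂ) : Matrix (Fin n) (Fin n) ℂ :=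
  Matrix.of fun j k => (z j * w j - conj (z k * w k)) / (z j - conj (z k))

lemma spec_aux {n : ℕ} (A : Matrix (Fin n) (Fin n) ℂ) (hA : A.PosSemidef) :
    ∃ (U : Matrix (Fin n) (Fin n) ℂ) (d : Fin n → ℝ), Uᴴ * U = 1 ∧ U * Uᴴ = 1 ∧ (∀ i, 0 ≤ d i) ∧
      A = U * diagonal (fun i => (d i : ℂ)) * Uᴴ := by
  refine ⟨hA.1.eigenvectorUnitary, hA.1.eigenvalues, ?_, ?_, hA.eigenvalues_nonneg, ?_⟩
  · exact Unitary.coe_star_mul_self _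
  · exact Unitary.coe_mul_star_self _
  · have := hA.1.spectral_theorem
    rw [Unitary.conjStarAlgAut_apply] at this
    exact this

lemma ker_aux {n : ℕ} (N P X : Matrix (Fin n) (Fin n) ℂ) (hN : N.PosSemidef) (hP : P.PosSemidef)
    (h : (N + P) * X = 0) : N * X = 0 := by
  ext i j
  have h1 : (N + P) *ᵥ (X.col j) = 0 := by
    ext k
    have := congrFun (congrFun h k) j
    simpa [Matrix.mul_apply, Matrix.mulVec, dotProduct] using this
  have h2 : star (X.col j) ⬝ᵥ (N *ᵥ X.col j) = 0 := by
    have a := hN.dotProduct_mulVec_nonneg (X.col j)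
    have b := hP.dotProduct_mulVec_nonneg (X.col j)
    have c : star (X.col j) ⬝ᵥ (N *ᵥ X.col j) + star (X.col j) ⬝ᵥ (P *ᵥ X.col j) = 0 := by
      rw [← dotProduct_add, ← add_mulVec, h1, dotProduct_zero]
    exact ((add_eq_zero_iff_of_nonneg a b).1 c).1
  have h3 := (hN.dotProduct_mulVec_zero_iff _).1 h2
  have := congrFun h3 i
  simpa [Matrix.mul_apply, Matrix.mulVec, dotProduct] using this

lemma simdiag {n : ℕ} (N P : Matrix (Fin n) (Fin n) ℂ) (hN : N.PosSemidef) (hP : P.PosSemidef) :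
    ∃ (K C : Matrix (Fin n) (Fin n) ℂ) (d : Fin n → ℝ), (∀ i, 0 ≤ d i) ∧ (∀ i, d i ≤ 1) ∧
      diagonal (fun i => (d i : ℂ)) * C = Kᴴ * P ∧
      diagonal (fun i => (1 - d i : ℂ)) * C = Kᴴ * N ∧
      N * (K * C) = N ∧ P * (K * C) = P := by
  obtain ⟨U, l, hU1, hU2, hl, hQ⟩ := spec_aux (N + P) (hN.add hP)
  set G : Matrix (Fin n) (Fin n) ℂ := U * diagonal (fun i => (((Real.sqrt (l i))⁻¹ : ℝ) : ℂ)) with hG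
  set T : Matrix (Fin n) (Fin n) ℂ := diagonal (fun i => ((Real.sqrt (l i) : ℝ) : ℂ)) * Uᴴ with hT
  set p : Fin n → ℂ := fun i => if l i = 0 then 0 else 1 with hp
  have hs : ∀ i, l i ≠ 0 → (Real.sqrt (l i)) ≠ 0 := fun i h =>
    (Real.sqrt_pos.2 (lt_of_le_of_ne (hl i) (Ne.symm h))).ne'
  have hGT : G * T = U * diagonal p * Uᴴ := by
    rw [hG, hT, ← mul_assoc, mul_assoc U, diagonal_mul_diagonal]
    congr 3
    funext i
    by_cases h : l i = 0
    · simp [hp, h]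
    · simp only [hp, h, if_false]
      rw [← Complex.ofReal_mul, inv_mul_cancel₀ (hs i h), Complex.ofReal_one]
  have hQGT : (N + P) * (G * T) = N + P := by
    rw [hGT, hQ]
    have : U * diagonal (fun i => (l i : ℂ)) * Uᴴ * (U * diagonal p * Uᴴ)
      = U * (diagonal (fun i => (l i : ℂ)) * (Uᴴ * U) * diagonal p) * Uᴴ := by
      simp only [mul_assoc]
    rw [this, hU1, mul_one, diagonal_mul_diagonal]
    congr 3
    funext i
    by_cases h : l i = 0 <;> simp [hp, h]
  have hk : (N + P) * (1 - G * T) = 0 := by rw [mul_sub, mul_one, hQGT, sub_self]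
  have hNG : N * (G * T) = N := by
    have := ker_aux N P _ hN hP hk
    rw [mul_sub, mul_one, sub_eq_zero] at this
    exact this.symm
  have hPG : P * (G * T) = P := by
    rw [add_comm] at hk
    have := ker_aux P N _ hP hN hk
    rw [mul_sub, mul_one, sub_eq_zero] at this
    exact this.symm
  have hGQG : Gᴴ * (N + P) * G = diagonal p := by
    rw [hG, hQ, conjTranspose_mul, diagonal_conjTranspose]
    have : ∀ D E F : Matrix (Fin n) (Fin n) ℂ, D * Uᴴ * (U * E * Uᴴ) * (U * F)
      = D * (Uᴴ * U) * E * (Uᴴ * U) * F := by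
      intro D E F
      simp only [mul_assoc]
    rw [this, hU1, mul_one, mul_one, diagonal_mul_diagonal, diagonal_mul_diagonal]
    congr 1
    funext i
    by_cases h : l i = 0
    · simp [hp, h]
    · simp only [hp, h, if_false, Pi.star_apply, Complex.star_def, Complex.conj_ofReal]
      rw [← Complex.ofReal_mul, ← Complex.ofReal_mul]
      nth_rewrite 2 [← Real.mul_self_sqrt (hl i)]
      rw [← mul_assoc, inv_mul_cancel₀ (hs i h), one_mul, mul_inv_cancel₀ (hs i h),
        Complex.ofReal_one]
  set A : Matrix (Fin n) (Fin n) ℂ := Gᴴ * P * G + diagonal (fun i => 1 - p i) with hA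
  set B : Matrix (Fin n) (Fin n) ℂ := Gᴴ * N * G with hB
  have hAB : A + B = 1 := by
    have : A + B = Gᴴ * (N + P) * G + diagonal (fun i => 1 - p i) := by
      rw [hA, hB, mul_add, add_mul]; abel
    rw [this, hGQG, diagonal_add, ← diagonal_one]
    congr 1; funext i; simp
  have hApsd : A.PosSemidef := by
    refine (hP.conjTranspose_mul_mul_same G).add (PosSemidef.diagonal ?_)
    intro i
    by_cases h : l i = 0 <;> simp [hp, h]
  have hBpsd : B.PosSemidef := hN.conjTranspose_mul_mul_same G
  obtain ⟨V, d, hV1, hV2, hd, hAV⟩ := spec_aux A hApsd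
  have hVA : Vᴴ * A = diagonal (fun i => (d i : ℂ)) * Vᴴ := by
    rw [hAV, ← mul_assoc, ← mul_assoc, hV1, one_mul]
  have hVB : Vᴴ * B = diagonal (fun i => (1 - d i : ℂ)) * Vᴴ := by
    have : B = 1 - A := by rw [← hAB]; abel
    rw [this, mul_sub, hVA, mul_one]
    have : diagonal (fun i => (1 - d i : ℂ)) = 1 - diagonal (fun i => (d i : ℂ)) := by
      rw [← diagonal_one, diagonal_sub]
    rw [this, sub_mul, one_mul]
  have hPT : diagonal (fun i => 1 - p i) * T = 0 := by
    rw [hT, ← mul_assoc, diagonal_mul_diagonal]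
    have : (fun i => (1 - p i) * ((Real.sqrt (l i) : ℝ) : ℂ)) = 0 := by
      funext i
      by_cases h : l i = 0 <;> simp [hp, h]
    rw [this]; simp
  refine ⟨G * V, Vᴴ * T, d, hd, ?_, ?_, ?_, ?_, ?_⟩
  · intro i
    have h := (hBpsd.conjTranspose_mul_mul_same V).diag_nonneg (i := i)
    rw [hVB, mul_assoc, hV1, mul_one, diagonal_apply_eq] at h
    have : (0:ℂ) ≤ ((1 - d i : ℝ) : ℂ) := by push_cast; exact h
    have := Complex.zero_le_real.1 this
    linarith
  · rw [← mul_assoc, ← hVA, hA, mul_assoc, add_mul, hPT, add_zero, conjTranspose_mul G V]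
    rw [mul_assoc (Gᴴ * P), mul_assoc Gᴴ P, hPG, mul_assoc]
  · rw [← mul_assoc, ← hVB, hB, mul_assoc, conjTranspose_mul G V]
    rw [mul_assoc (Gᴴ * N), mul_assoc Gᴴ N, hNG, mul_assoc]
  · rw [mul_assoc G, ← mul_assoc V, hV2, one_mul, hNG]
  · rw [mul_assoc G, ← mul_assoc V, hV2, one_mul, hPG]

lemma den_ne {d : ℝ} (h0 : 0 ≤ d) (h1 : d ≤ 1) {z : ℂ} (hz : z ∈ SDom) :
    (d : ℂ) - (1 - d) * z ≠ 0 := by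
  intro h
  have hre := congrArg Complex.re h
  have him := congrArg Complex.im h
  simp at hre him
  apply hz
  rcases him with him | him
  · have : d = 1 := by linarith
    subst this; simp at hre
  · refine ⟨?_, him⟩
    rcases eq_or_lt_of_le h1 with h | h
    · subst h; simp at hre
    · have : (1 - d) * z.re = d := by linarith
      by_contra hc
      push Not at hc
      nlinarith

lemma stieltjes_sum {n : ℕ} (a d : Fin n → ℝ) (ha : ∀ i, 0 ≤ a i) (h0 : ∀ i, 0 ≤ d i)
    (h1 : ∀ i, d i ≤ 1) :
    StieltjesClass (fun z => ∑ i, (a i : ℂ) / ((d i : ℂ) - (1 - d i) * z)) := by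
  refine ⟨?_, ?_⟩
  · intro z hz
    refine Finset.analyticAt_fun_sum _ fun i _ => ?_
    exact analyticAt_const.div (by fun_prop) (den_ne (h0 i) (h1 i) hz)
  by_cases hc : ∃ i, 0 < a i ∧ d i < 1
  · right
    obtain ⟨i₀, hi, hi'⟩ := hc
    refine ⟨?_, ?_, ?_⟩
    · intro z hz
      have hzD : z ∈ SDom := fun h => hz.ne' h.2
      have him : ∀ i, ((a i : ℂ) / ((d i : ℂ) - (1 - d i) * z)).im
          = a i * ((1 - d i) * z.im) / Complex.normSq ((d i : ℂ) - (1 - d i) * z) := by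
        intro i
        rw [Complex.div_im]
        simp
        ring
      rw [Complex.im_sum]
      refine Finset.sum_pos' ?_ ⟨i₀, Finset.mem_univ _, ?_⟩
      · intro i _
        rw [him]
        have := h1 i
        exact div_nonneg (mul_nonneg (ha i) (mul_nonneg (by linarith) hz.le))
          (Complex.normSq_nonneg _)
      · rw [him]
        exact div_pos (mul_pos hi (mul_pos (by linarith) hz))
          (Complex.normSq_pos.2 (den_ne (h0 _) (h1 _) hzD))
    · intro x hx
      refine ⟨∑ i, a i / (d i - (1 - d i) * x), ?_, by push_cast; rfl⟩
      have key : ∀ i, 0 < d i - (1 - d i) * x := by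
        intro i
        have := h0 i
        have := h1 i
        rcases eq_or_lt_of_le (h1 i) with h | h
        · rw [h]; simp
        · nlinarith
      refine Finset.sum_pos' (fun i _ => div_nonneg (ha i) (key i).le)
        ⟨i₀, Finset.mem_univ _, div_pos hi (key _)⟩
    · intro z _
      simp
  · left
    push Not at hc
    refine ⟨∑ i, a i, Finset.sum_nonneg fun i _ => ha i, ?_⟩
    intro z _
    push_cast
    refine Finset.sum_congr rfl fun i _ => ?_
    rcases eq_or_lt_of_le (ha i) with h | h
    · rw [← h]; simp
    · have := hc i h
      have : d i = 1 := le_antisymm (h1 i) this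
      rw [this]; simp

lemma sub_conj_ne {a b : ℂ} (ha : 0 < a.im) (hb : 0 < b.im) : a - conj b ≠ 0 := by
  intro h
  have := congrArg Complex.im h
  simp at this
  linarith

lemma backward_dir (n : ℕ) (z w : Fin n → ℂ) (hz : ∀ j, 0 < (z j).im)
    (hN : (NPmatN n z w).PosSemidef) (hP : (NPmatP n z w).PosSemidef) :
    ∃ f : ℂ → ℂ, StieltjesClass f ∧ ∀ j, f (z j) = w j := by
  obtain ⟨K, C, d, h0, h1, hdP, hdN, hNK, hPK⟩ := simdiag _ _ hN hP
  have hrel : ∀ j k, NPmatP n z w j k - z j * NPmatN n z w j k = conj (w k) := by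
    intro j k
    have := sub_conj_ne (hz j) (hz k)
    simp only [NPmatP, NPmatN, Matrix.of_apply, map_mul]
    field_simp
    ring
  have hrel' : ∀ j k, NPmatP n z w k j - conj (z j) * NPmatN n z w k j = w k := by
    intro j k
    have := sub_conj_ne (hz k) (hz j)
    simp only [NPmatP, NPmatN, Matrix.of_apply, map_mul]
    field_simp
    ring
  set e : Fin n → ℂ := fun i => ∑ k, conj (K k i) * w k with he
  refine ⟨_, stieltjes_sum (fun i => Complex.normSq (e i)) d (fun i => Complex.normSq_nonneg _) h0 h1, ?_⟩
  intro j
  have hzD : z j ∈ SDom := fun h => (hz j).ne' h.2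
  have hC : ∀ i, ((d i : ℂ) - (1 - d i) * conj (z j)) * C i j = e i := by
    intro i
    have a := congrFun (congrFun hdP i) j
    have b := congrFun (congrFun hdN i) j
    rw [diagonal_mul, Matrix.mul_apply] at a b
    have : ((d i : ℂ) - (1 - d i) * conj (z j)) * C i j
      = d i * C i j - conj (z j) * ((1 - d i) * C i j) := by ring
    rw [this, a, b, Finset.mul_sum, ← Finset.sum_sub_distrib, he]
    refine Finset.sum_congr rfl fun k _ => ?_
    simp only [conjTranspose_apply, Complex.star_def]
    rw [← hrel' j k]
    ring
  have hterm : ∀ i, ((Complex.normSq (e i) : ℝ) : ℂ) / ((d i : ℂ) - (1 - d i) * z j)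
      = e i * conj (C i j) := by
    intro i
    have hne := den_ne (h0 i) (h1 i) hzD
    rw [div_eq_iff hne, Complex.normSq_eq_conj_mul_self, mul_comm (conj (e i)), mul_assoc]
    congr 1
    rw [← hC i]
    simp
    ring
  simp only [hterm]
  have hw : ∑ k, conj (w k) * (K * C) k j = conj (w j) := by
    have a := congrFun (congrFun hNK j) j
    have b := congrFun (congrFun hPK j) j
    rw [Matrix.mul_apply] at a b
    rw [← hrel j j, ← b, ← a, Finset.mul_sum, ← Finset.sum_sub_distrib]
    refine Finset.sum_congr rfl fun k _ => ?_
    rw [← hrel j k]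
    ring
  have := congrArg conj hw
  simp only [map_sum, map_mul, Complex.conj_conj] at this
  rw [← this, he]
  simp only [Finset.sum_mul]
  rw [Finset.sum_comm]
  refine Finset.sum_congr rfl fun k _ => ?_
  rw [Matrix.mul_apply, map_sum, Finset.mul_sum]
  refine Finset.sum_congr rfl fun i _ => ?_
  rw [map_mul]; ring

lemma pick_disc {n : ℕ} (g : ℂ → ℂ) (c : ℂ) (r : ℝ) (hr : 0 < r)
    (hg : DifferentiableOn ℂ g (Metric.closedBall c r))
    (hre : ∀ z ∈ Metric.sphere c r, 0 ≤ (g z).re)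
    (z : Fin n → ℂ) (hz : ∀ j, z j ∈ Metric.ball c r) (x : Fin n → ℂ) :
    0 ≤ (∑ j, ∑ k, conj (x j) * x k *
      ((g (z j) + conj (g (z k))) / ((r : ℂ) ^ 2 - (z j - c) * conj (z k - c)))).re := by
  have hden : ∀ k, ∀ ζ ∈ Metric.closedBall c r, (r : ℂ) ^ 2 - (ζ - c) * conj (z k - c) ≠ 0 := by
    intro k ζ hζ h
    have h1 : (r : ℂ) ^ 2 = (ζ - c) * conj (z k - c) := sub_eq_zero.1 h
    have h2 := congrArg norm h1
    rw [norm_mul, RCLike.norm_conj, norm_pow, Complex.norm_real, Real.norm_of_nonneg hr.le] at h2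
    have h3 : ‖ζ - c‖ ≤ r := by simpa [dist_eq_norm] using hζ
    have h4 : ‖z k - c‖ < r := by simpa [dist_eq_norm] using hz k
    have := norm_nonneg (ζ - c)
    have := norm_nonneg (z k - c)
    nlinarith
  set h : ℂ → ℂ := fun ζ => ∑ k, x k / ((r : ℂ) ^ 2 - (ζ - c) * conj (z k - c)) with hh
  have hhd : DifferentiableOn ℂ h (Metric.closedBall c r) := by
    refine DifferentiableOn.fun_sum fun k _ => ?_
    refine DifferentiableOn.div (by fun_prop) (by fun_prop) (hden k)
  set J : ℂ := ∑ j, conj (x j) * (g (z j) * h (z j)) with hJ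
  have hcau : ∀ j, (∮ ζ in C(c, r), (ζ - z j)⁻¹ • (g ζ * h ζ)) = (2 * Real.pi * I : ℂ) • (g (z j) * h (z j)) :=
    fun j => (hg.mul hhd).circleIntegral_sub_inv_smul (hz j)
  have hint : ∀ j, CircleIntegrable (fun ζ => conj (x j) * ((ζ - z j)⁻¹ • (g ζ * h ζ))) c r := by
    intro j
    refine ContinuousOn.circleIntegrable hr.le ?_
    have hc : ContinuousOn (fun ζ => g ζ * h ζ) (Metric.sphere c r) :=
      (hg.mul hhd).continuousOn.mono Metric.sphere_subset_closedBall
    refine ContinuousOn.mul continuousOn_const (ContinuousOn.smul (ContinuousOn.inv₀ (continuousOn_id.sub continuousOn_const) ?_) hc)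
    intro ζ hζ h0
    have h4 := hz j
    replace h0 : ζ - z j = 0 := h0
    rw [sub_eq_zero] at h0
    rw [← h0] at h4
    simp only [Metric.mem_sphere, Metric.mem_ball] at hζ h4
    linarith
  have hJint : (2 * Real.pi * I : ℂ) * J =
      ∮ ζ in C(c, r), ∑ j, conj (x j) * ((ζ - z j)⁻¹ • (g ζ * h ζ)) := by
    rw [circleIntegral.integral_fun_sum (fun j _ => hint j), hJ, Finset.mul_sum]
    refine Finset.sum_congr rfl fun j _ => ?_
    rw [circleIntegral.integral_const_mul, hcau, smul_eq_mul]
    ring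
  have hpt : ∀ θ : ℝ, deriv (circleMap c r) θ • (∑ j, conj (x j) * ((circleMap c r θ - z j)⁻¹ •
      (g (circleMap c r θ) * h (circleMap c r θ)))) =
      I * (g (circleMap c r θ) *
        (Complex.normSq (∑ j, conj (x j) * (circleMap c r θ - z j)⁻¹) : ℝ)) := by
    intro θ
    set ζ := circleMap c r θ with hζ
    have hζs : ζ ∈ Metric.sphere c r := circleMap_mem_sphere c hr.le θ
    have hn : ‖ζ - c‖ = r := by simpa [dist_eq_norm] using hζs
    have hne : ζ - c ≠ 0 := by
      intro h0; rw [h0, norm_zero] at hn; linarith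
    have hrr : (r : ℂ) ^ 2 = (ζ - c) * conj (ζ - c) := by
      rw [Complex.mul_conj, Complex.normSq_eq_norm_sq, hn]; push_cast; rfl
    have hd : deriv (circleMap c r) θ = (ζ - c) * I := by
      rw [deriv_circleMap, hζ]; simp [circleMap]
    have hhζ : (ζ - c) * h ζ = conj (∑ j, conj (x j) * (ζ - z j)⁻¹) := by
      rw [hh, map_sum, Finset.mul_sum]
      refine Finset.sum_congr rfl fun k _ => ?_
      rw [hrr, ← mul_sub, ← map_sub]
      rw [map_mul, Complex.conj_conj, map_inv₀]
      rw [show ζ - c - (z k - c) = ζ - z k by ring, mul_div_assoc', mul_div_mul_left _ _ hne, div_eq_mul_inv]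
    rw [← Complex.mul_conj, ← hhζ, hd]
    simp only [smul_eq_mul]
    have : ∑ j, conj (x j) * ((ζ - z j)⁻¹ * (g ζ * h ζ)) =
        (∑ j, conj (x j) * (ζ - z j)⁻¹) * (g ζ * h ζ) := by
      rw [Finset.sum_mul]
      exact Finset.sum_congr rfl fun j _ => by ring
    rw [this]; ring
  have hJre : 0 ≤ J.re := by
    unfold circleIntegral at hJint
    simp only [hpt] at hJint
    rw [intervalIntegral.integral_const_mul] at hJint
    have h2 : J = (2 * Real.pi : ℝ)⁻¹ * ∫ θ in (0:ℝ)..2 * Real.pi, (g (circleMap c r θ) *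
        (Complex.normSq (∑ j, conj (x j) * (circleMap c r θ - z j)⁻¹) : ℝ)) := by
      have hpi : (Real.pi : ℂ) ≠ 0 := by exact_mod_cast Real.pi_ne_zero
      have : I * ((2 * Real.pi : ℝ) * J) = I * ∫ θ in (0:ℝ)..2 * Real.pi, (g (circleMap c r θ) *
        (Complex.normSq (∑ j, conj (x j) * (circleMap c r θ - z j)⁻¹) : ℝ)) := by
        rw [← hJint]; push_cast; ring
      rw [← mul_left_cancel₀ I_ne_zero this]
      push_cast
      field_simp
    rw [h2]
    rw [Complex.re_ofReal_mul]
    refine mul_nonneg (by positivity) ?_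
    have hii : IntervalIntegrable (fun θ => g (circleMap c r θ) *
        ((Complex.normSq (∑ j, conj (x j) * (circleMap c r θ - z j)⁻¹) : ℝ) : ℂ)) volume 0 (2 * Real.pi) := by
      apply Continuous.intervalIntegrable
      refine Continuous.mul ?_ ?_
      · exact hg.continuousOn.comp_continuous (continuous_circleMap c r)
          (fun θ => circleMap_mem_closedBall c hr.le θ)
      · refine Complex.continuous_ofReal.comp (Complex.continuous_normSq.comp ?_)
        refine continuous_finsetSum _ fun j _ => continuous_const.mul (Continuous.inv₀ ?_ ?_)
        · exact (continuous_circleMap c r).sub continuous_const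
        · intro θ h0
          have hζ := circleMap_mem_sphere c hr.le θ
          have h4 := hz j
          rw [sub_eq_zero] at h0
          rw [← h0] at h4
          simp only [Metric.mem_sphere, Metric.mem_ball] at hζ h4
          linarith
    have hreI := Complex.reCLM.intervalIntegral_comp_comm hii
    simp only [Complex.reCLM_apply] at hreI
    rw [← hreI]
    refine intervalIntegral.integral_nonneg (by positivity) fun θ _ => ?_
    rw [mul_comm, Complex.re_ofReal_mul]
    exact mul_nonneg (Complex.normSq_nonneg _) (hre _ (circleMap_mem_sphere c hr.le θ))
  have hJ1 : J = ∑ j, ∑ k, conj (x j) * x k *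
      (g (z j) / ((r : ℂ) ^ 2 - (z j - c) * conj (z k - c))) := by
    rw [hJ]
    refine Finset.sum_congr rfl fun j _ => ?_
    rw [hh]
    simp only [Finset.mul_sum]
    exact Finset.sum_congr rfl fun k _ => by ring
  have hJ2 : conj J = ∑ j, ∑ k, conj (x j) * x k *
      (conj (g (z k)) / ((r : ℂ) ^ 2 - (z j - c) * conj (z k - c))) := by
    rw [hJ1, Finset.sum_comm]
    simp only [map_sum]
    refine Finset.sum_congr rfl fun j _ => Finset.sum_congr rfl fun k _ => ?_
    simp only [map_mul, map_div₀, map_sub, map_pow, Complex.conj_conj, Complex.conj_ofReal]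
    ring
  have : (∑ j, ∑ k, conj (x j) * x k *
      ((g (z j) + conj (g (z k))) / ((r : ℂ) ^ 2 - (z j - c) * conj (z k - c)))) = J + conj J := by
    rw [hJ2]
    nth_rewrite 1 [hJ1]
    rw [← Finset.sum_add_distrib]
    refine Finset.sum_congr rfl fun j _ => ?_
    rw [← Finset.sum_add_distrib]
    refine Finset.sum_congr rfl fun k _ => ?_
    ring
  rw [this, Complex.add_re, Complex.conj_re]
  linarith

open Filter Topology in
lemma pick_half {n : ℕ} (f : ℂ → ℂ) (hf : ∀ z : ℂ, 0 < z.im → DifferentiableAt ℂ f z)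
    (him : ∀ z : ℂ, 0 < z.im → 0 ≤ (f z).im) (z : Fin n → ℂ) (hz : ∀ j, 0 < (z j).im) :
    (NPmatN n z (fun j => f (z j))).PosSemidef := by
  have hH : (NPmatN n z (fun j => f (z j))).IsHermitian := by
    ext j k
    simp only [NPmatN, conjTranspose_apply, Matrix.of_apply, Complex.star_def, map_div₀, map_sub,
      Complex.conj_conj]
    rw [← neg_sub, ← neg_sub (z j), neg_div_neg_eq]
  refine PosSemidef.of_dotProduct_mulVec_nonneg hH fun x => ?_
  rw [Complex.nonneg_iff]
  refine ⟨?_, (hH.im_star_dotProduct_mulVec_self x).symm⟩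
  have hform : star x ⬝ᵥ NPmatN n z (fun j => f (z j)) *ᵥ x = ∑ j, ∑ k, conj (x j) * x k *
      ((-I * f (z j) + conj (-I * f (z k))) / (-I * (z j - conj (z k)))) := by
    simp only [dotProduct, mulVec, Finset.mul_sum, NPmatN, Matrix.of_apply]
    refine Finset.sum_congr rfl fun j _ => Finset.sum_congr rfl fun k _ => ?_
    have : -I * f (z j) + conj (-I * f (z k)) = -I * (f (z j) - conj (f (z k))) := by
      simp; ring
    rw [this, mul_div_mul_left _ _ (neg_ne_zero.2 I_ne_zero)]
    simp; ring
  rw [hform]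
  -- limit over discs
  have hlim : Tendsto (fun R : ℝ => (∑ j, ∑ k, conj (x j) * x k *
      ((-I * f (z j) + conj (-I * f (z k))) /
        (-I * (z j - conj (z k)) + (R : ℂ)⁻¹ * (-1 - z j * conj (z k))))).re) atTop
      (𝓝 (∑ j, ∑ k, conj (x j) * x k *
      ((-I * f (z j) + conj (-I * f (z k))) / (-I * (z j - conj (z k))))).re) := by
    refine (Complex.continuous_re.tendsto _).comp ?_
    refine tendsto_finsetSum _ fun j _ => tendsto_finsetSum _ fun k _ => ?_
    refine Tendsto.mul tendsto_const_nhds (Tendsto.div tendsto_const_nhds ?_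
      (mul_ne_zero (neg_ne_zero.2 I_ne_zero) (sub_conj_ne (hz j) (hz k))))
    have h1 : Tendsto (fun R : ℝ => (R : ℂ)⁻¹) atTop (𝓝 0) := by
      have := (Complex.continuous_ofReal.tendsto 0).comp (tendsto_inv_atTop_zero (𝕜 := ℝ))
      simpa [Function.comp_def] using this
    have h2 := (h1.mul_const (-1 - z j * conj (z k))).const_add (-I * (z j - conj (z k)))
    simpa using h2
  refine ge_of_tendsto hlim ?_
  have hev : ∀ᶠ R : ℝ in atTop, ∀ j, Complex.normSq (z j) + 1 < 2 * R * (z j).im := by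
    rw [eventually_all]
    intro j
    filter_upwards [eventually_gt_atTop ((Complex.normSq (z j) + 1) / (2 * (z j).im))] with R hR
    rw [div_lt_iff₀ (by have := hz j; positivity)] at hR
    linarith
  filter_upwards [hev, eventually_gt_atTop (1:ℝ)] with R hR hR1
  have hR0 : 0 < R := by linarith
  have hrpos : 0 < R ^ 2 - 1 := by nlinarith
  set r := Real.sqrt (R ^ 2 - 1) with hr
  have hr0 : 0 < r := Real.sqrt_pos.2 hrpos
  have hr2 : r ^ 2 = R ^ 2 - 1 := Real.sq_sqrt hrpos.le
  have hrR : r < R := by nlinarith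
  have hball : ∀ ζ ∈ Metric.closedBall (I * R) r, 0 < ζ.im := by
    intro ζ hζ
    have h1 : ‖ζ - I * R‖ ≤ r := by simpa [dist_eq_norm] using hζ
    have h2 := (Complex.abs_im_le_norm (ζ - I * R)).trans h1
    simp at h2
    have := (abs_le.1 h2).1
    linarith
  have hzb : ∀ j, z j ∈ Metric.ball (I * R) r := by
    intro j
    rw [Metric.mem_ball, dist_eq_norm]
    refine lt_of_pow_lt_pow_left₀ 2 hr0.le ?_
    rw [← Complex.normSq_eq_norm_sq, hr2]
    have := hR j
    rw [Complex.normSq_apply] at this ⊢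
    simp
    nlinarith
  have key := pick_disc (fun ζ => -I * f ζ) (I * R) r hr0
    (fun ζ hζ => ((hf ζ (hball ζ hζ)).const_mul _).differentiableWithinAt)
    (fun ζ hζ => by
      have := him ζ (hball ζ (Metric.sphere_subset_closedBall hζ))
      simpa using this) z hzb x
  have hRC : (R : ℂ) ≠ 0 := by exact_mod_cast hR0.ne'
  have hscale : (∑ j, ∑ k, conj (x j) * x k *
      ((-I * f (z j) + conj (-I * f (z k))) /
        (-I * (z j - conj (z k)) + (R : ℂ)⁻¹ * (-1 - z j * conj (z k))))) = (R : ℂ) *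
      ∑ j, ∑ k, conj (x j) * x k *
      ((-I * f (z j) + conj (-I * f (z k))) / ((r : ℂ) ^ 2 - (z j - I * R) * conj (z k - I * R))) := by
    simp only [Finset.mul_sum]
    refine Finset.sum_congr rfl fun j _ => Finset.sum_congr rfl fun k _ => ?_
    have hr2C : (r : ℂ) ^ 2 = (R : ℂ) ^ 2 - 1 := by exact_mod_cast hr2
    have : (r : ℂ) ^ 2 - (z j - I * R) * conj (z k - I * R) =
        R * (-I * (z j - conj (z k)) + (R : ℂ)⁻¹ * (-1 - z j * conj (z k))) := by
      rw [hr2C, mul_add, mul_inv_cancel_left₀ hRC]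
      simp
      linear_combination ((R:ℂ)^2) * Complex.I_sq
    rw [this, div_mul_eq_div_div_swap, mul_left_comm, mul_div_assoc', mul_div_cancel₀ _ hRC, mul_div_assoc]
  rw [hscale, Complex.re_ofReal_mul]
  exact mul_nonneg hR0.le key

open Filter Topology in
lemma im_mul_nonneg (f : ℂ → ℂ) (hf : AnalyticOnNhd ℂ f SDom)
    (h1 : ∀ z : ℂ, 0 < z.im → 0 < (f z).im)
    (h2 : ∀ x : ℝ, x < 0 → ∃ r : ℝ, 0 < r ∧ f (x : ℂ) = (r : ℂ)) (z : ℂ) (hz : 0 < z.im) :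
    0 ≤ (z * f z).im := by
  have hpi := Real.pi_pos
  -- exp of points in the strip
  have hexp : ∀ ζ : ℂ, 0 < ζ.im → ζ.im ≤ Real.pi →
      cexp ζ ∈ SDom ∧ f (cexp ζ) ∈ slitPlane ∧ 0 ≤ (f (cexp ζ)).arg ∧ (f (cexp ζ)).arg ≤ Real.pi ∧
        (ζ.im = Real.pi → (f (cexp ζ)).arg = 0) := by
    intro ζ h0 hp
    rcases eq_or_lt_of_le hp with h | h
    · have he : cexp ζ = ((-Real.exp ζ.re : ℝ) : ℂ) := by
        apply Complex.ext
        · rw [Complex.exp_re, h, Real.cos_pi, Complex.ofReal_re]; ring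
        · rw [Complex.exp_im, h]; simp
      have hneg : -Real.exp ζ.re < 0 := by have := Real.exp_pos ζ.re; linarith
      obtain ⟨r, hr, hfr⟩ := h2 _ hneg
      rw [he, hfr]
      refine ⟨?_, Or.inl (by simpa using hr), ?_⟩
      · rintro ⟨a, _⟩
        rw [Complex.ofReal_re] at a
        linarith
      · rw [Complex.arg_ofReal_of_nonneg hr.le]
        exact ⟨le_rfl, hpi.le, fun _ => rfl⟩
    · have hi : 0 < (cexp ζ).im := by
        rw [Complex.exp_im]
        exact mul_pos (Real.exp_pos _) (Real.sin_pos_of_pos_of_lt_pi h0 h)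
      have hfi := h1 _ hi
      refine ⟨fun a => hi.ne' a.2, Or.inr hfi.ne', Complex.arg_nonneg_iff.2 hfi.le,
        Complex.arg_le_pi _, fun a => absurd a h.ne⟩
  set F : ℂ → ℂ := fun ζ => cexp (-I * (ζ + Complex.log (f (cexp ζ)))) with hF
  have hFnorm : ∀ ζ, ‖F ζ‖ = Real.exp (ζ.im + (f (cexp ζ)).arg) := by
    intro ζ
    rw [hF, Complex.norm_exp]
    simp [Complex.log_im]
  have hFd : ∀ ζ : ℂ, 0 < ζ.im → ζ.im ≤ Real.pi → DifferentiableAt ℂ F ζ := by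
    intro ζ h0 hp
    obtain ⟨a, b, _⟩ := hexp ζ h0 hp
    have hfe : DifferentiableAt ℂ (fun ζ => f (cexp ζ)) ζ :=
      (hf _ a).differentiableAt.comp ζ Complex.differentiableAt_exp
    exact ((differentiableAt_id.add (hfe.clog b)).const_mul (-I)).cexp
  set ζ₀ := Complex.log z with hζ₀
  have hz0 : z ≠ 0 := by rintro rfl; simp at hz
  have heζ : cexp ζ₀ = z := Complex.exp_log hz0
  have hζim : ζ₀.im = z.arg := Complex.log_im z
  have hargle : z.arg ≤ Real.pi := Complex.arg_le_pi z
  have hargpos : 0 < z.arg := by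
    refine lt_of_le_of_ne (Complex.arg_nonneg_iff.2 hz.le) fun h => ?_
    have := (Complex.arg_eq_zero_iff.1 h.symm).2
    exact hz.ne' this
  have hmain : ∀ ε : ℝ, 0 < ε → z.arg + (f z).arg ≤ Real.pi + ε := by
    intro ε hε
    set a := min (min ε z.arg) (Real.pi / 2) with ha
    have ha0 : 0 < a := lt_min (lt_min hε hargpos) (by positivity)
    have haε : a ≤ ε := (min_le_left _ _).trans (min_le_left _ _)
    have haz : a ≤ z.arg := (min_le_left _ _).trans (min_le_right _ _)
    have hap : a < Real.pi := lt_of_le_of_lt (min_le_right _ _) (by linarith)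
    have hle : ‖F ζ₀‖ ≤ Real.exp (Real.pi + ε) := by
      refine PhragmenLindelof.horizontal_strip (a := a) (b := Real.pi) (f := F) ?_ ?_ ?_ ?_ ?_ ?_
      · apply DifferentiableOn.diffContOnCl
        intro ζ hζ
        have hcl : closure (im ⁻¹' Set.Ioo a Real.pi) ⊆ im ⁻¹' Set.Icc a Real.pi :=
          closure_minimal (Set.preimage_mono Set.Ioo_subset_Icc_self)
            (isClosed_Icc.preimage Complex.continuous_im)
        have := hcl hζ
        exact (hFd ζ (ha0.trans_le this.1) this.2).differentiableWithinAt
      · refine ⟨0, div_pos hpi (by linarith), 0, ?_⟩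
        refine Asymptotics.IsBigO.of_bound (Real.exp (2 * Real.pi)) ?_
        refine Filter.Eventually.filter_mono inf_le_right ?_
        rw [Filter.eventually_principal]
        intro ζ hζ
        have hh := hexp ζ (ha0.trans hζ.1) hζ.2.le
        have := hζ.2
        simp only [zero_mul, Real.exp_zero, norm_one, mul_one]
        rw [hFnorm]
        exact Real.exp_le_exp.2 (by linarith [hh.2.2.2.1])
      · intro ζ hζ
        rw [hFnorm]
        have hh := hexp ζ (by linarith) (by linarith)
        exact Real.exp_le_exp.2 (by linarith [hh.2.2.2.1])
      · intro ζ hζ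
        rw [hFnorm]
        have hh := hexp ζ (by linarith) (by linarith)
        rw [hh.2.2.2.2 hζ]
        exact Real.exp_le_exp.2 (by linarith)
      · rw [hζim]; exact haz
      · rw [hζim]; exact hargle
    rw [hFnorm, heζ, hζim] at hle
    exact Real.exp_le_exp.1 hle
  have hsum : z.arg + (f z).arg ≤ Real.pi := le_of_forall_pos_le_add hmain
  have hf0 : 0 ≤ (f z).arg := Complex.arg_nonneg_iff.2 (h1 z hz).le
  have hprod : z * f z = ((‖z‖ * ‖f z‖ : ℝ) : ℂ) * cexp (((z.arg + (f z).arg : ℝ) : ℂ) * I) := by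
    have e1 := Complex.norm_mul_exp_arg_mul_I z
    have e2 := Complex.norm_mul_exp_arg_mul_I (f z)
    push_cast
    rw [add_mul, Complex.exp_add]
    calc z * f z = (‖z‖ * cexp (z.arg * I)) * (‖f z‖ * cexp ((f z).arg * I)) := by rw [e1, e2]
      _ = _ := by ring
  rw [hprod, Complex.im_ofReal_mul, Complex.exp_ofReal_mul_I_im]
  exact mul_nonneg (by positivity) (Real.sin_nonneg_of_nonneg_of_le_pi (by linarith) hsum)

lemma forward_dir (n : ℕ) (z w : Fin n → ℂ) (hz : ∀ j, 0 < (z j).im)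
    (f : ℂ → ℂ) (hf : StieltjesClass f) (hw : ∀ j, f (z j) = w j) :
    (NPmatN n z w).PosSemidef ∧ (NPmatP n z w).PosSemidef := by
  obtain ⟨han, hcase⟩ := hf
  have hD : ∀ z : ℂ, 0 < z.im → z ∈ SDom := fun z hz h => hz.ne' h.2
  have hdiff : ∀ z : ℂ, 0 < z.im → DifferentiableAt ℂ f z := fun z hz =>
    (han z (hD z hz)).differentiableAt
  have him : ∀ z : ℂ, 0 < z.im → 0 ≤ (f z).im ∧ 0 ≤ (z * f z).im := by
    intro z hz
    rcases hcase with ⟨c, hc, hfc⟩ | ⟨h1, h2, _⟩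
    · rw [hfc z (hD z hz)]
      simp
      positivity
    · exact ⟨(h1 z hz).le, im_mul_nonneg f han h1 h2 z hz⟩
  have hw' : w = fun j => f (z j) := funext fun j => (hw j).symm
  subst hw'
  refine ⟨pick_half f hdiff (fun z hz => (him z hz).1) z hz, ?_⟩
  exact pick_half (fun z => z * f z) (fun z hz => differentiableAt_id.mul (hdiff z hz))
    (fun z hz => (him z hz).2) z hz

theorem statement3 (n : ℕ) (z w : Fin n → ℂ)
    (hz : ∀ j, 0 < (z j).im) (hinj : Function.Injective z) :
    (∃ f : ℂ → ℂ, StieltjesClass f ∧ ∀ j, f (z j) = w j) ↔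
      (NPmatN n z w).PosSemidef ∧ (NPmatP n z w).PosSemidef := by
  constructor
  · rintro ⟨f, hf, hw⟩
    exact forward_dir n z w hz f hf hw
  · rintro ⟨hN, hP⟩
    exact backward_dir n z w hz hN hP
end
end

section
/- Let z₁,…,zₙ be pairwise distinct points of ℍ₊ and let w ∈ ℂⁿ be such that both Nevanlinna–Pick matrices N(z,w) and P(z,w) are positive semidefinite, and at least one of N(z,w), P(z,w) is singular (has rank < n). Then there is exactly one function f in the Stieltjes class 𝔖 with f(z_j) = w_j for all j = 1,…,n, and this f is rational: there exist polynomials p, q over ℂ with q ≠ 0 such that f(z) = p(z)/q(z) for all z ∈ ℂ ∖ [0,∞). -/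
open Complex MeasureTheory Polynomial Matrix
open scoped ComplexConjugate ComplexOrder

noncomputable section

lemma disc_pick {ι : Type*} [Fintype ι] {F : ℂ → ℂ} {c : ℂ} {R : ℝ} (hR : 0 < R)
    (hF : DiffContOnCl ℂ F (Metric.ball c R))
    (hIm : ∀ ζ ∈ Metric.sphere c R, 0 ≤ (F ζ).im) (a x : ι → ℂ)
    (ha : ∀ j, a j ∈ Metric.ball c R) :
    0 ≤ (∑ j, ∑ k, conj (x j) * x k *
      (F (a j) / ((R : ℂ) ^ 2 - (a j - c) * conj (a k - c)))).im := by
  have hden : ∀ k, ∀ ζ ∈ Metric.closedBall c R, (R : ℂ) ^ 2 - (ζ - c) * conj (a k - c) ≠ 0 := by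
    intro k ζ hζ h
    have h1 : (R : ℂ) ^ 2 = (ζ - c) * conj (a k - c) := sub_eq_zero.1 h
    have h2 := congrArg norm h1
    simp only [norm_mul, norm_pow, Complex.norm_real, Complex.norm_conj, Real.norm_eq_abs,
      abs_of_pos hR] at h2
    have h3 : ‖ζ - c‖ ≤ R := by simpa [dist_eq_norm] using hζ
    have h4 : ‖a k - c‖ < R := by simpa [dist_eq_norm] using ha k
    nlinarith [norm_nonneg (ζ - c), norm_nonneg (a k - c)]
  have hne : ∀ k, ∀ ζ ∈ Metric.sphere c R, ζ - a k ≠ 0 := by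
    intro k ζ hζ h
    have h4 : ‖a k - c‖ < R := by simpa [dist_eq_norm] using ha k
    have h3 : ‖ζ - c‖ = R := by simpa [dist_eq_norm] using hζ
    rw [sub_eq_zero.1 h] at h3
    linarith
  have hne0 : ∀ ζ ∈ Metric.sphere c R, ζ - c ≠ 0 := by
    intro ζ hζ h
    have h3 : ‖ζ - c‖ = R := by simpa [dist_eq_norm] using hζ
    rw [h] at h3
    simp at h3; linarith
  have hcs : closure (Metric.ball c R) = Metric.closedBall c R := closure_ball _ hR.ne'
  have hFc : ContinuousOn F (Metric.closedBall c R) := hcs ▸ hF.2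
  have hsub : Metric.sphere c R ⊆ Metric.closedBall c R := Metric.sphere_subset_closedBall
  -- the term functions
  let T : ι → ι → ℂ → ℂ := fun j k ζ =>
    ((ζ - c) / (ζ - a j)) • (conj (x j) * x k * (F ζ / ((R : ℂ) ^ 2 - (ζ - c) * conj (a k - c))))
  have hT : ∀ j k, Real.circleAverage (T j k) c R =
      conj (x j) * x k * (F (a j) / ((R : ℂ) ^ 2 - (a j - c) * conj (a k - c))) := by
    intro j k
    have hd : DiffContOnCl ℂ (fun ζ => conj (x j) * x k *
        (F ζ / ((R : ℂ) ^ 2 - (ζ - c) * conj (a k - c)))) (Metric.ball c |R|) := by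
      rw [abs_of_pos hR]
      refine ⟨?_, ?_⟩
      · refine DifferentiableOn.const_mul (DifferentiableOn.div hF.1 (by fun_prop) ?_) _
        intro ζ hζ; exact hden k ζ (Metric.ball_subset_closedBall hζ)
      · rw [hcs]
        refine ContinuousOn.mul continuousOn_const (ContinuousOn.div hFc (by fun_prop) (hden k))
    exact hd.circleAverage_smul_div (by rw [abs_of_pos hR]; exact ha j)
  have hTi : ∀ j k, CircleIntegrable (T j k) c R := by
    intro j k
    apply ContinuousOn.circleIntegrable hR.le
    refine ContinuousOn.smul (ContinuousOn.div (by fun_prop) (by fun_prop) (hne j)) ?_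
    refine ContinuousOn.mul continuousOn_const (ContinuousOn.div (hFc.mono hsub) (by fun_prop) ?_)
    intro ζ hζ; exact hden k ζ (hsub hζ)
  have hsum : Real.circleAverage (fun ζ => ∑ j, ∑ k, T j k ζ) c R = ∑ j, ∑ k, conj (x j) * x k *
      (F (a j) / ((R : ℂ) ^ 2 - (a j - c) * conj (a k - c))) := by
    rw [Real.circleAverage_fun_sum]
    · refine Finset.sum_congr rfl fun j _ => ?_
      rw [Real.circleAverage_fun_sum]
      · exact Finset.sum_congr rfl fun k _ => hT j k
      · intro k _; exact hTi j k
    · intro j _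
      exact CircleIntegrable.fun_sum _ fun k _ => hTi j k
  have hTsumInt : CircleIntegrable (fun ζ => ∑ j, ∑ k, T j k ζ) c R :=
    CircleIntegrable.fun_sum _ fun j _ => CircleIntegrable.fun_sum _ fun k _ => hTi j k
  rw [← hsum]
  have him : (Real.circleAverage (fun ζ => ∑ j, ∑ k, T j k ζ) c R).im =
      Real.circleAverage (fun ζ => (∑ j, ∑ k, T j k ζ).im) c R := by
    have := ContinuousLinearMap.circleAverage_comp_comm Complex.imCLM hTsumInt
    exact this.symm
  rw [him]
  apply Real.circleAverage_nonneg_of_nonneg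
  intro ζ hζ
  rw [abs_of_pos hR] at hζ
  have key : (∑ j, ∑ k, T j k ζ) =
      F ζ * (((R ^ 2)⁻¹ * Complex.normSq (∑ j, conj (x j) * ((ζ - c) / (ζ - a j))) : ℝ) : ℂ) := by
    have hc2 : conj (ζ - c) = (R : ℂ) ^ 2 / (ζ - c) := by
      rw [eq_div_iff (hne0 ζ hζ), mul_comm, Complex.mul_conj]
      have h3 : ‖ζ - c‖ = R := by simpa [dist_eq_norm] using hζ
      rw [Complex.normSq_eq_norm_sq, h3]; push_cast; rfl
    push_cast
    rw [← Complex.mul_conj, map_sum, Finset.sum_mul_sum, Finset.mul_sum, Finset.mul_sum]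
    refine Finset.sum_congr rfl fun j _ => ?_
    rw [Finset.mul_sum, Finset.mul_sum]
    refine Finset.sum_congr rfl fun k _ => ?_
    have hb : conj (ζ - a k) = ((R : ℂ) ^ 2 - (ζ - c) * conj (a k - c)) / (ζ - c) := by
      have : ζ - a k = (ζ - c) - (a k - c) := by ring
      rw [this, map_sub, hc2]
      field_simp [hne0 ζ hζ]
    simp only [T, map_mul, map_div₀, Complex.conj_conj, smul_eq_mul]
    rw [hc2, hb]
    have h1 := hne0 ζ hζ
    have h2 := hden k ζ (hsub hζ)
    have h3 := hne j ζ hζ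
    have h4 : (R : ℂ) ≠ 0 := by exact_mod_cast hR.ne'
    field_simp
  show 0 ≤ (∑ j, ∑ k, T j k ζ).im
  rw [key, Complex.im_mul_ofReal]
  have := hIm ζ hζ
  have := Complex.normSq_nonneg (∑ j, conj (x j) * ((ζ - c) / (ζ - a j)))
  positivity

lemma hp_pick {ι : Type*} [Fintype ι] {F : ℂ → ℂ}
    (hF : ∀ ζ : ℂ, 0 < ζ.im → DifferentiableAt ℂ F ζ)
    (hIm : ∀ ζ : ℂ, 0 < ζ.im → 0 ≤ (F ζ).im) (a x : ι → ℂ) (ha : ∀ j, 0 < (a j).im) :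
    0 ≤ (∑ j, ∑ k, conj (x j) * x k * (F (a j) / (a j - conj (a k)))).re := by
  have hne : ∀ j k, a j - conj (a k) ≠ 0 := by
    intro j k h
    have := congrArg Complex.im h
    simp at this
    linarith [ha j, ha k]
  let G : ℝ → ℂ := fun s => ∑ j, ∑ k, conj (x j) * x k * (F (a j) /
    ((-2 + ((s : ℂ)⁻¹) ^ 2) * (s : ℂ)⁻¹ - I * (a j - conj (a k)) - a j * conj (a k) * (s : ℂ)⁻¹))
  have hinv : Filter.Tendsto (fun s : ℝ => (s : ℂ)⁻¹) Filter.atTop (nhds 0) := by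
    have := (Complex.continuous_ofReal.tendsto 0).comp tendsto_inv_atTop_zero
    simpa [Function.comp_def] using this
  have hlim : Filter.Tendsto G Filter.atTop (nhds (∑ j, ∑ k, conj (x j) * x k * (F (a j) /
      ((-2 + (0 : ℂ) ^ 2) * 0 - I * (a j - conj (a k)) - a j * conj (a k) * 0)))) := by
    refine tendsto_finsetSum _ fun j _ => tendsto_finsetSum _ fun k _ => ?_
    refine Filter.Tendsto.const_mul _ (Filter.Tendsto.div tendsto_const_nhds ?_ ?_)
    · exact (((tendsto_const_nhds.add (hinv.pow 2)).mul hinv).sub tendsto_const_nhds).sub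
        (tendsto_const_nhds.mul hinv)
    · simpa using hne j k
  have hev : ∀ᶠ s : ℝ in Filter.atTop, 0 ≤ (G s).im := by
    have h1 : ∀ᶠ s : ℝ in Filter.atTop, ∀ j, ‖a j‖ ^ 2 + 2 < 2 * s * (a j).im := by
      rw [Filter.eventually_all]
      intro j
      filter_upwards [Filter.eventually_gt_atTop ((‖a j‖ ^ 2 + 2) / (2 * (a j).im))] with s hs
      rw [div_lt_iff₀ (by linarith [ha j])] at hs
      linarith
    filter_upwards [h1, Filter.eventually_gt_atTop 1] with s hs hs1
    have hs0 : (0 : ℝ) < s := by linarith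
    have hsinv : 0 < s⁻¹ := by positivity
    have hsinv1 : s⁻¹ < 1 := inv_lt_one_of_one_lt₀ hs1
    have hmul : s * s⁻¹ = 1 := mul_inv_cancel₀ hs0.ne'
    have hr : 0 < s - s⁻¹ := by linarith
    have hball : ∀ ζ ∈ Metric.closedBall ((s : ℂ) * I) (s - s⁻¹), 0 < ζ.im := by
      intro ζ hζ
      have h2 : ‖ζ - s * I‖ ≤ s - s⁻¹ := by simpa [dist_eq_norm] using hζ
      have h3 := (Complex.abs_im_le_norm (ζ - s * I)).trans h2
      simp at h3
      have := (abs_le.1 h3).1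
      linarith
    have hd := disc_pick (F := F) (c := (s : ℂ) * I) hr
      (DifferentiableOn.diffContOnCl (by
        rw [closure_ball _ hr.ne']
        intro ζ hζ; exact (hF ζ (hball ζ hζ)).differentiableWithinAt))
      (fun ζ hζ => hIm ζ (hball ζ (Metric.sphere_subset_closedBall hζ))) a x (by
        intro j
        rw [Metric.mem_ball, dist_eq_norm]
        refine lt_of_pow_lt_pow_left₀ 2 hr.le ?_
        rw [← Complex.normSq_eq_norm_sq, Complex.normSq_apply]
        have := hs j
        rw [← Complex.normSq_eq_norm_sq, Complex.normSq_apply] at this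
        simp
        nlinarith [sq_nonneg s⁻¹])
    have hGs : G s = (s : ℂ) * ∑ j, ∑ k, conj (x j) * x k * (F (a j) /
        (((s - s⁻¹ : ℝ) : ℂ) ^ 2 - (a j - s * I) * conj (a k - s * I))) := by
      simp only [G]
      rw [Finset.mul_sum]
      refine Finset.sum_congr rfl fun j _ => ?_
      rw [Finset.mul_sum]
      refine Finset.sum_congr rfl fun k _ => ?_
      have hsc : (s : ℂ) ≠ 0 := by exact_mod_cast hs0.ne'
      have : (((s - s⁻¹ : ℝ) : ℂ) ^ 2 - (a j - s * I) * conj (a k - s * I)) =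
         (s : ℂ) * ((-2 + ((s : ℂ)⁻¹) ^ 2) * (s : ℂ)⁻¹ - I * (a j - conj (a k))
          - a j * conj (a k) * (s : ℂ)⁻¹) := by
        simp only [map_sub, map_mul, Complex.conj_ofReal, Complex.conj_I]
        push_cast
        field_simp
        linear_combination ((s : ℂ) ^ 4) * Complex.I_sq
      rw [this, div_mul_eq_div_div_swap]
      field_simp
    rw [hGs, Complex.im_ofReal_mul]
    exact mul_nonneg hs0.le hd
  have hfin := ge_of_tendsto ((Complex.continuous_im.tendsto _).comp hlim) hev
  have : (∑ j, ∑ k, conj (x j) * x k * (F (a j) /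
      ((-2 + (0 : ℂ) ^ 2) * 0 - I * (a j - conj (a k)) - a j * conj (a k) * 0))) =
      I * ∑ j, ∑ k, conj (x j) * x k * (F (a j) / (a j - conj (a k))) := by
    rw [Finset.mul_sum]
    refine Finset.sum_congr rfl fun j _ => ?_
    rw [Finset.mul_sum]
    refine Finset.sum_congr rfl fun k _ => ?_
    have h1 : ((-2 + (0 : ℂ) ^ 2) * 0 - I * (a j - conj (a k)) - a j * conj (a k) * 0)
      = - I * (a j - conj (a k)) := by ring
    rw [h1, div_mul_eq_div_div, div_neg, Complex.div_I]
    ring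
  rw [this] at hfin
  simpa using hfin

lemma pick_posSemidef {F : ℂ → ℂ}
    (hF : ∀ ζ : ℂ, 0 < ζ.im → DifferentiableAt ℂ F ζ)
    (hIm : ∀ ζ : ℂ, 0 < ζ.im → 0 ≤ (F ζ).im) (n : ℕ) (a w : Fin n → ℂ) (ha : ∀ j, 0 < (a j).im)
    (hw : ∀ j, F (a j) = w j) :
    (NPmatN n a w).PosSemidef := by
  refine Matrix.PosSemidef.of_dotProduct_mulVec_nonneg ?_ ?_
  · ext j k
    simp only [NPmatN, Matrix.conjTranspose_apply, Matrix.of_apply, star_def, map_div₀, map_sub,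
      Complex.conj_conj]
    rw [← neg_sub, ← neg_sub (a j), neg_div_neg_eq]
  · intro x
    have h := hp_pick hF hIm a x ha
    set T := ∑ j, ∑ k, conj (x j) * x k * (F (a j) / (a j - conj (a k))) with hT
    have : star x ⬝ᵥ NPmatN n a w *ᵥ x = T + conj T := by
      have hc : conj T = ∑ j, ∑ k, conj (x j) * x k * (-conj (F (a k)) / (a j - conj (a k))) := by
        rw [hT, map_sum, Finset.sum_congr rfl fun j _ => map_sum _ _ _, Finset.sum_comm]
        refine Finset.sum_congr rfl fun j _ => Finset.sum_congr rfl fun k _ => ?_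
        simp only [map_mul, map_div₀, map_sub, Complex.conj_conj]
        rw [← neg_sub (a j), div_neg, neg_div]
        ring
      rw [hc, hT, ← Finset.sum_add_distrib, dotProduct]
      refine Finset.sum_congr rfl fun j _ => ?_
      rw [← Finset.sum_add_distrib, mulVec, dotProduct, Finset.mul_sum]
      refine Finset.sum_congr rfl fun k _ => ?_
      simp only [NPmatN, Matrix.of_apply, Pi.star_apply, star_def, ← hw]
      ring
    rw [this, Complex.add_conj]
    exact_mod_cast (by linarith : 0 ≤ 2 * T.re)

lemma sdom_of_im {ζ : ℂ} (h : 0 < ζ.im) : ζ ∈ SDom := by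
  intro h'; linarith [h'.2]

lemma sdom_preconnected : IsPreconnected SDom := by
  have hs : StarConvex ℝ (-1 : ℂ) SDom := by
    intro y hy s t hs ht hst h
    simp only [Complex.add_re, Complex.add_im, Complex.smul_re, Complex.smul_im, smul_eq_mul,
      Complex.neg_re, Complex.neg_im, Complex.one_re, Complex.one_im] at h
    obtain ⟨h1, h2⟩ := h
    have h2' : t * y.im = 0 := by linarith
    rcases mul_eq_zero.1 h2' with h3 | h3
    · have : s = 1 := by linarith
      rw [h3, this] at h1; linarith
    · apply hy
      refine ⟨?_, h3⟩
      by_contra hneg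
      push Not at hneg
      have : t * y.re ≤ 0 := mul_nonpos_of_nonneg_of_nonpos ht hneg.le
      have hs0 : s = 0 := by linarith
      have ht1 : t = 1 := by linarith
      rw [hs0, ht1] at h1
      linarith
  exact (hs.isPathConnected (by
    intro h; have := h.1; norm_num at this)).isConnected.isPreconnected

lemma stieltjes_im_nonneg {g : ℂ → ℂ} (hg : StieltjesClass g) {ζ : ℂ} (hζ : 0 < ζ.im) :
    0 ≤ (g ζ).im := by
  rcases hg.2 with ⟨c, _, h⟩ | ⟨h, _⟩
  · rw [h ζ (sdom_of_im hζ)]; simp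
  · exact (h ζ hζ).le

lemma stieltjes_mul_im_nonneg {g : ℂ → ℂ} (hg : StieltjesClass g) {ζ : ℂ} (hζ : 0 < ζ.im) :
    0 ≤ (ζ * g ζ).im := by
  rcases hg.2 with ⟨c, hc, h⟩ | ⟨h1, h2, -⟩
  · rw [h ζ (sdom_of_im hζ), Complex.im_mul_ofReal]; positivity
  -- points of the strip
  have hexp : ∀ s : ℂ, 0 < s.im → s.im ≤ Real.pi →
      Complex.exp s ∈ SDom ∧ g (Complex.exp s) ∈ slitPlane ∧ 0 ≤ Complex.arg (g (Complex.exp s)) ∧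
        (s.im = Real.pi → Complex.arg (g (Complex.exp s)) = 0) := by
    intro s hs0 hs1
    rcases hs1.lt_or_eq with hlt | heq
    · have him : 0 < (Complex.exp s).im := by
        rw [Complex.exp_im]
        exact mul_pos (Real.exp_pos _) (Real.sin_pos_of_pos_of_lt_pi hs0 hlt)
      refine ⟨sdom_of_im him, Or.inr (h1 _ him).ne', ?_, fun h => absurd h hlt.ne⟩
      exact Complex.arg_nonneg_iff.2 (h1 _ him).le
    · have he : Complex.exp s = ((-Real.exp s.re : ℝ) : ℂ) := by
        apply Complex.ext
        · rw [Complex.exp_re, heq, Complex.ofReal_re]; simp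
        · rw [Complex.exp_im, heq]; simp
      have hneg : -Real.exp s.re < 0 := neg_lt_zero.2 (Real.exp_pos _)
      obtain ⟨r, hr, hgr⟩ := h2 _ hneg
      rw [he, hgr]
      refine ⟨?_, ?_, ?_, fun _ => ?_⟩
      · intro h; have := h.1; rw [Complex.ofReal_re] at this; linarith
      · left; simpa using hr
      · rw [Complex.arg_ofReal_of_nonneg hr.le]
      · rw [Complex.arg_ofReal_of_nonneg hr.le]
  let F : ℂ → ℂ := fun s => Complex.exp (-I * (s + Complex.log (g (Complex.exp s))))
  have hnorm : ∀ s, ‖F s‖ = Real.exp (s.im + Complex.arg (g (Complex.exp s))) := by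
    intro s
    simp only [F, Complex.norm_exp]
    simp [Complex.log_im]
  have hdiff : ∀ s : ℂ, 0 < s.im → s.im ≤ Real.pi → DifferentiableAt ℂ F s := by
    intro s hs0 hs1
    obtain ⟨ha, hb, -⟩ := hexp s hs0 hs1
    have hgd : DifferentiableAt ℂ g (Complex.exp s) := (hg.1 _ ha).differentiableAt
    have hc : DifferentiableAt ℂ (fun s => g (Complex.exp s)) s :=
      DifferentiableAt.comp (g := g) s hgd Complex.differentiableAt_exp
    exact ((differentiableAt_id.add (hc.clog hb)).const_mul _).cexp
  -- main bound
  have hbound : ∀ s : ℂ, 0 < s.im → s.im ≤ Real.pi →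
      s.im + Complex.arg (g (Complex.exp s)) ≤ Real.pi := by
    intro s hs0 hs1
    refine le_of_forall_pos_le_add fun ε hε => ?_
    set δ := min (min ε s.im) (Real.pi / 2) with hδ
    have hδ0 : 0 < δ := lt_min (lt_min hε hs0) (by positivity)
    have hδε : δ ≤ ε := (min_le_left _ _).trans (min_le_left _ _)
    have hδs : δ ≤ s.im := (min_le_left _ _).trans (min_le_right _ _)
    have hδπ : δ < Real.pi := (min_le_right _ _).trans_lt (by linarith [Real.pi_pos])
    have hcl : closure (Complex.im ⁻¹' Set.Ioo δ Real.pi) ⊆ Complex.im ⁻¹' Set.Icc δ Real.pi :=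
      closure_minimal (Set.preimage_mono Set.Ioo_subset_Icc_self)
        (isClosed_Icc.preimage Complex.continuous_im)
    have key : ‖F s‖ ≤ Real.exp (Real.pi + δ) := by
      refine PhragmenLindelof.horizontal_strip (a := δ) (b := Real.pi) ?_ ?_ ?_ ?_ hδs hs1
      · apply DifferentiableOn.diffContOnCl
        intro u hu
        have := hcl hu
        exact (hdiff u (hδ0.trans_le this.1) this.2).differentiableWithinAt
      · refine ⟨0, div_pos Real.pi_pos (by linarith), 0, ?_⟩
        apply Asymptotics.IsBigO.of_bound (Real.exp (Real.pi + Real.pi))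
        refine Filter.Eventually.filter_mono inf_le_right ?_
        rw [Filter.eventually_principal]
        intro u hu
        rw [hnorm]
        simp only [zero_mul, Real.exp_zero, norm_one, mul_one]
        exact Real.exp_le_exp.2 (add_le_add hu.2.le (Complex.arg_le_pi _))
      · intro u hu
        rw [hnorm, hu, add_comm Real.pi]
        exact Real.exp_le_exp.2 (add_le_add le_rfl (Complex.arg_le_pi _))
      · intro u hu
        rw [hnorm, (hexp u (by rw [hu]; exact Real.pi_pos) hu.le).2.2.2 hu, hu]
        exact Real.exp_le_exp.2 (by linarith)
    rw [hnorm, Real.exp_le_exp] at key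
    linarith
  have hζ0 : ζ ≠ 0 := by rintro rfl; simp at hζ
  have harg : 0 < Complex.arg ζ := by
    refine lt_of_le_of_ne (Complex.arg_nonneg_iff.2 hζ.le) fun h => ?_
    have := Complex.arg_eq_zero_iff.1 h.symm
    linarith [this.2]
  have hb := hbound (Complex.log ζ) (by rw [Complex.log_im]; exact harg)
    (by rw [Complex.log_im]; exact Complex.arg_le_pi _)
  rw [Complex.exp_log hζ0, Complex.log_im] at hb
  have h0 : 0 ≤ Complex.arg (g ζ) := Complex.arg_nonneg_iff.2 (h1 ζ hζ).le
  have hg0 : g ζ ≠ 0 := by intro h; have := h1 ζ hζ; rw [h] at this; simp at this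
  rw [← Complex.arg_nonneg_iff]
  by_cases hle : Complex.arg ζ + Complex.arg (g ζ) ≤ Real.pi
  · rw [Complex.arg_mul hζ0 hg0 ⟨by linarith [Real.pi_pos], hle⟩]
    linarith
  · exact absurd hb hle

lemma cauchy_sum_ne_zero {n : ℕ} (b c : Fin n → ℂ) (hb : Function.Injective b)
    (hbim : ∀ k, (b k).im < 0) (hc : c ≠ 0) :
    ∃ ζ : ℂ, 0 < ζ.im ∧ ∑ k, c k / (ζ - b k) ≠ 0 := by
  by_contra hcon
  push Not at hcon
  let p : Polynomial ℂ := ∑ k, Polynomial.C (c k) *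
    ∏ l ∈ Finset.univ.erase k, (Polynomial.X - Polynomial.C (b l))
  have hp : p = 0 := by
    apply Polynomial.eq_zero_of_infinite_isRoot
    have hinf : Set.Infinite {ζ : ℂ | 0 < ζ.im} := by
      have : (Set.range fun m : ℕ => ((m : ℂ) + 1) * I).Infinite := by
        apply Set.infinite_range_of_injective
        intro m m' h
        have := congrArg Complex.im h
        simpa using this
      refine this.mono ?_
      rintro _ ⟨m, rfl⟩
      simp
      positivity
    refine hinf.mono ?_
    intro ζ hζ
    have hζ' : 0 < ζ.im := hζ
    have hne : ∀ k, ζ - b k ≠ 0 := by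
      intro k h
      have := congrArg Complex.im h
      simp at this
      linarith [hbim k]
    show Polynomial.eval ζ p = 0
    simp only [p, Polynomial.eval_finsetSum, Polynomial.eval_mul, Polynomial.eval_C,
      Polynomial.eval_prod, Polynomial.eval_sub, Polynomial.eval_X]
    have : ∀ k, c k * ∏ l ∈ Finset.univ.erase k, (ζ - b l) =
        (c k / (ζ - b k)) * ∏ l, (ζ - b l) := by
      intro k
      rw [← Finset.mul_prod_erase Finset.univ _ (Finset.mem_univ k)]
      have := hne k
      field_simp
    rw [Finset.sum_congr rfl fun k _ => this k, ← Finset.sum_mul, hcon ζ hζ', zero_mul]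
  apply hc
  funext k
  have he : Polynomial.eval (b k) p = 0 := by rw [hp]; simp
  simp only [p, Polynomial.eval_finsetSum, Polynomial.eval_mul, Polynomial.eval_C,
      Polynomial.eval_prod, Polynomial.eval_sub, Polynomial.eval_X] at he
  rw [Finset.sum_eq_single k] at he
  · refine (mul_eq_zero.1 he).resolve_right ?_
    refine Finset.prod_ne_zero_iff.2 ?_
    intro l hl h
    exact (Finset.ne_of_mem_erase hl) (hb (sub_eq_zero.1 h)).symm
  · intro m _ hm
    rw [Finset.prod_eq_zero (Finset.mem_erase.2 ⟨hm.symm, Finset.mem_univ k⟩) (sub_self _), mul_zero]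
  · simp

lemma nev_ext {F : ℂ → ℂ} (hF : ∀ ζ : ℂ, 0 < ζ.im → DifferentiableAt ℂ F ζ)
    (hIm : ∀ ζ : ℂ, 0 < ζ.im → 0 ≤ (F ζ).im) {n : ℕ} (z w c : Fin n → ℂ)
    (hz : ∀ j, 0 < (z j).im) (hw : ∀ j, F (z j) = w j) (hc : NPmatN n z w *ᵥ c = 0)
    {ζ : ℂ} (hζ : 0 < ζ.im) :
    F ζ * ∑ k, c k / (ζ - conj (z k)) = ∑ k, conj (w k) * c k / (ζ - conj (z k)) := by
  have hps := pick_posSemidef hF hIm (n + 1) (Fin.cons ζ z) (Fin.cons (F ζ) w)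
    (fun j => by refine Fin.cases ?_ ?_ j <;> simp [hζ, hz])
    (fun j => by refine Fin.cases ?_ ?_ j <;> simp [hw])
  have hmv : ∀ j, (NPmatN n z w *ᵥ c) j = 0 := fun j => by rw [hc]; rfl
  have h0 : star (Fin.cons 0 c : Fin (n + 1) → ℂ) ⬝ᵥ
      (NPmatN (n + 1) (Fin.cons ζ z) (Fin.cons (F ζ) w) *ᵥ (Fin.cons 0 c : Fin (n + 1) → ℂ)) = 0 := by
    rw [dotProduct, Fin.sum_univ_succ]
    simp only [Pi.star_apply, Fin.cons_zero, star_zero, zero_mul, zero_add]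
    refine Finset.sum_eq_zero fun j _ => ?_
    have := hmv j
    simp only [mulVec, dotProduct, NPmatN, Matrix.of_apply] at this
    simp only [mulVec, dotProduct, NPmatN, Matrix.of_apply, Fin.sum_univ_succ, Fin.cons_zero,
      Fin.cons_succ, mul_zero, zero_add, this]
  have h1 := congrFun ((hps.dotProduct_mulVec_zero_iff _).1 h0) 0
  simp only [mulVec, dotProduct, NPmatN, Matrix.of_apply, Fin.sum_univ_succ, Fin.cons_zero,
      Fin.cons_succ, mul_zero, zero_add, Pi.zero_apply] at h1
  rw [Finset.mul_sum, ← sub_eq_zero, ← Finset.sum_sub_distrib, ← h1]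
  refine Finset.sum_congr rfl fun k _ => ?_
  ring

lemma nev_unique {F G : ℂ → ℂ} (hF : ∀ ζ : ℂ, 0 < ζ.im → DifferentiableAt ℂ F ζ)
    (hFim : ∀ ζ : ℂ, 0 < ζ.im → 0 ≤ (F ζ).im)
    (hG : ∀ ζ : ℂ, 0 < ζ.im → DifferentiableAt ℂ G ζ)
    (hGim : ∀ ζ : ℂ, 0 < ζ.im → 0 ≤ (G ζ).im) {n : ℕ} (z w : Fin n → ℂ)
    (hz : ∀ j, 0 < (z j).im) (hinj : Function.Injective z)
    (hFw : ∀ j, F (z j) = w j) (hGw : ∀ j, G (z j) = w j) (hdet : (NPmatN n z w).det = 0) :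
    ∃ ζ : ℂ, 0 < ζ.im ∧ ∀ᶠ u in nhds ζ, F u = G u := by
  obtain ⟨c, hc0, hc⟩ := Matrix.exists_mulVec_eq_zero_iff.2 hdet
  obtain ⟨ζ, hζ, hne⟩ := cauchy_sum_ne_zero (fun k => conj (z k)) c
    (fun i j h => hinj (star_injective h)) (fun k => by simpa using hz k) hc0
  refine ⟨ζ, hζ, ?_⟩
  have hcont : ContinuousAt (fun u : ℂ => ∑ k, c k / (u - conj (z k))) ζ := by
    refine tendsto_finsetSum _ fun k _ => ?_
    refine ContinuousAt.div (by fun_prop) (by fun_prop) ?_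
    intro h
    have := congrArg Complex.im h
    simp at this
    linarith [hz k]
  have hopen : ∀ᶠ u : ℂ in nhds ζ, 0 < u.im :=
    (isOpen_lt continuous_const Complex.continuous_im).mem_nhds hζ
  filter_upwards [hcont.eventually_ne hne, hopen] with u hu hu0
  exact mul_right_cancel₀ hu ((nev_ext hF hFim z w c hz hFw hc hu0).trans
    (nev_ext hG hGim z w c hz hGw hc hu0).symm)

lemma stieltjes_unique {f g : ℂ → ℂ} (hf : StieltjesClass f) (hg : StieltjesClass g)
    {n : ℕ} (z w : Fin n → ℂ)
    (hz : ∀ j, 0 < (z j).im) (hinj : Function.Injective z)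
    (hfw : ∀ j, f (z j) = w j) (hgw : ∀ j, g (z j) = w j)
    (hsing : (NPmatN n z w).det = 0 ∨ (NPmatP n z w).det = 0) :
    ∀ ζ ∈ SDom, g ζ = f ζ := by
  have hd : ∀ {h : ℂ → ℂ}, StieltjesClass h → ∀ ζ : ℂ, 0 < ζ.im → DifferentiableAt ℂ h ζ :=
    fun hh ζ hζ => (hh.1 ζ (sdom_of_im hζ)).differentiableAt
  have key : ∃ ζ : ℂ, 0 < ζ.im ∧ ∀ᶠ u in nhds ζ, g u = f u := by
    rcases hsing with h | h
    · exact nev_unique (hd hg) (fun ζ hζ => stieltjes_im_nonneg hg hζ) (hd hf)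
        (fun ζ hζ => stieltjes_im_nonneg hf hζ) z w hz hinj hgw hfw h
    · obtain ⟨ζ, hζ, he⟩ := nev_unique (F := fun u => u * g u) (G := fun u => u * f u)
        (fun ζ hζ => differentiableAt_id.mul (hd hg ζ hζ))
        (fun ζ hζ => stieltjes_mul_im_nonneg hg hζ)
        (fun ζ hζ => differentiableAt_id.mul (hd hf ζ hζ))
        (fun ζ hζ => stieltjes_mul_im_nonneg hf hζ) z (fun j => z j * w j) hz hinj
        (fun j => by rw [hgw]) (fun j => by rw [hfw]) h
      refine ⟨ζ, hζ, ?_⟩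
      have hopen : ∀ᶠ u : ℂ in nhds ζ, 0 < u.im :=
        (isOpen_lt continuous_const Complex.continuous_im).mem_nhds hζ
      filter_upwards [he, hopen] with u hu hu0
      exact mul_left_cancel₀ (by rintro rfl; simp at hu0) hu
  obtain ⟨ζ, hζ, he⟩ := key
  exact hg.1.eqOn_of_preconnected_of_eventuallyEq hf.1 sdom_preconnected (sdom_of_im hζ) he

lemma psd_real {n : ℕ} {A : Matrix (Fin n) (Fin n) ℂ} (hA : A.PosSemidef) (x : Fin n → ℂ) :
    ∃ a : ℝ, 0 ≤ a ∧ star x ⬝ᵥ (A *ᵥ x) = (a : ℂ) := by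
  have h := Complex.nonneg_iff.1 (hA.dotProduct_mulVec_nonneg x)
  exact ⟨_, h.1, Complex.ext rfl (by simpa using h.2.symm)⟩

lemma herm_swap {n : ℕ} {A : Matrix (Fin n) (Fin n) ℂ} (hA : A.IsHermitian) (x y : Fin n → ℂ) :
    star x ⬝ᵥ (A *ᵥ y) = star (A *ᵥ x) ⬝ᵥ y := by
  rw [star_mulVec, hA.eq, dotProduct_mulVec]

lemma psd_pencil {n : ℕ} {A B : Matrix (Fin n) (Fin n) ℂ} (hA : A.PosSemidef) (hB : B.PosSemidef)
    {ζ : ℂ} (hζ : ζ ∈ SDom) {x : Fin n → ℂ} (h : A *ᵥ x = ζ • (B *ᵥ x)) :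
    A *ᵥ x = 0 ∧ B *ᵥ x = 0 := by
  obtain ⟨a, ha, hax⟩ := psd_real hA x
  obtain ⟨b, hb, hbx⟩ := psd_real hB x
  have h1 : (a : ℂ) = ζ * b := by
    rw [← hax, ← hbx, h, dotProduct_smul, smul_eq_mul]
  have hb0 : b = 0 := by
    by_contra hne
    have hbpos : 0 < b := lt_of_le_of_ne hb (Ne.symm hne)
    apply hζ
    have hre := congrArg Complex.re h1
    have him := congrArg Complex.im h1
    simp at hre him
    refine ⟨?_, him.resolve_right hne⟩
    by_contra hneg
    push Not at hneg
    have := mul_neg_of_neg_of_pos hneg hbpos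
    linarith
  have hBx : B *ᵥ x = 0 := by
    rw [← hB.dotProduct_mulVec_zero_iff, hbx, hb0]; simp
  exact ⟨by rw [h, hBx, smul_zero], hBx⟩

lemma exists_compl {n : ℕ} (K : Submodule ℂ (Fin n → ℂ)) :
    ∃ T : Matrix (Fin n) (Fin n) ℂ, (∀ x, T *ᵥ x ∈ K) ∧ ∀ x ∈ K, T *ᵥ x = x := by
  obtain ⟨g, hg⟩ := LinearMap.exists_leftInverse_of_injective K.subtype (by simp)
  refine ⟨LinearMap.toMatrix' (K.subtype ∘ₗ g), fun x => ?_, fun x hx => ?_⟩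
  · rw [LinearMap.toMatrix'_mulVec]; simp
  · rw [LinearMap.toMatrix'_mulVec]
    have := congrArg (K.subtype) (LinearMap.congr_fun hg ⟨x, hx⟩)
    simpa using this

lemma existence_core (n : ℕ) (z w : Fin n → ℂ) (N P : Matrix (Fin n) (Fin n) ℂ)
    (hN : N.PosSemidef) (hP : P.PosSemidef) (hz : ∀ j, 0 < (z j).im)
    (hNP : ∀ j k, P j k = z j * N j k + conj (w k)) :
    ∃ f : ℂ → ℂ, StieltjesClass f ∧ (∀ j, f (z j) = w j) ∧
        ∃ p q : Polynomial ℂ, q ≠ 0 ∧ ∀ ζ ∈ SDom, f ζ = p.eval ζ / q.eval ζ := by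
  obtain ⟨T, hTK, hTid⟩ := exists_compl (LinearMap.ker N.mulVecLin ⊓ LinearMap.ker P.mulVecLin)
  have hTN : ∀ x, N *ᵥ (T *ᵥ x) = 0 := fun x => by simpa using (hTK x).1
  have hTP : ∀ x, P *ᵥ (T *ᵥ x) = 0 := fun x => by simpa using (hTK x).2
  have hTid' : ∀ x, N *ᵥ x = 0 → P *ᵥ x = 0 → T *ᵥ x = x := fun x h1 h2 =>
    hTid x ⟨by simpa using h1, by simpa using h2⟩
  have hrow : ∀ x j, (P *ᵥ x) j = z j * (N *ᵥ x) j + star w ⬝ᵥ x := by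
    intro x j
    simp only [mulVec, dotProduct, Finset.mul_sum, ← Finset.sum_add_distrib, hNP]
    refine Finset.sum_congr rfl fun k _ => ?_
    simp only [Pi.star_apply, star_def]; ring
  have hperp : ∀ x, N *ᵥ x = 0 → P *ᵥ x = 0 → star w ⬝ᵥ x = 0 := by
    intro x h1 h2
    rcases n with _ | n
    · simp [dotProduct]
    · have := hrow x 0
      rw [h1, h2] at this
      simpa using this.symm
  set Q := T * Tᴴ with hQ
  have hQpsd : Q.PosSemidef := posSemidef_self_mul_conjTranspose T
  have hPQ : (P + Q).PosSemidef := hP.add hQpsd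
  have hdet : ∀ ζ ∈ SDom, (P + Q - ζ • N).det ≠ 0 := by
    intro ζ hζ hd
    obtain ⟨x, hx0, hx⟩ := Matrix.exists_mulVec_eq_zero_iff.2 hd
    rw [sub_mulVec, smul_mulVec, sub_eq_zero] at hx
    obtain ⟨h1, h2⟩ := psd_pencil hPQ hN hζ hx
    rw [add_mulVec] at h1
    have hm : (-1 : ℂ) ∈ SDom := by intro h; have := h.1; norm_num at this
    obtain ⟨h3, h4⟩ := psd_pencil hP hQpsd hm (x := x) (by
      rw [eq_neg_of_add_eq_zero_left h1]; simp)
    have h5 : Tᴴ *ᵥ x = 0 := (self_mul_conjTranspose_mulVec_eq_zero T x).1 h4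
    apply hx0
    rw [← dotProduct_star_self_eq_zero]
    nth_rewrite 2 [← hTid' x h2 h3]
    rw [dotProduct_mulVec, ← conjTranspose_conjTranspose T, ← star_mulVec, h5]
    simp
  -- polynomials
  let AP : Matrix (Fin n) (Fin n) ℂ[X] := (P + Q).map Polynomial.C - (X : ℂ[X]) • N.map Polynomial.C
  let q : ℂ[X] := AP.det
  let p : ℂ[X] := ∑ i, ∑ j, Polynomial.C (star (w i)) * (AP.adjugate i j * Polynomial.C (w j))
  have hAPmap : ∀ ζ : ℂ, (Polynomial.evalRingHom ζ).mapMatrix AP = P + Q - ζ • N := by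
    intro ζ
    ext i j
    simp [AP]
    exact mul_comm _ _
  have hqe : ∀ ζ : ℂ, q.eval ζ = (P + Q - ζ • N).det := by
    intro ζ
    rw [← hAPmap, ← RingHom.map_det]; rfl
  have hpe : ∀ ζ : ℂ, p.eval ζ = star w ⬝ᵥ ((P + Q - ζ • N).adjugate *ᵥ w) := by
    intro ζ
    rw [← hAPmap, ← RingHom.map_adjugate]
    simp only [p, Polynomial.eval_finsetSum, dotProduct, mulVec, Finset.mul_sum]
    refine Finset.sum_congr rfl fun i _ => Finset.sum_congr rfl fun j _ => ?_
    simp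
  have hq0 : ∀ ζ ∈ SDom, q.eval ζ ≠ 0 := fun ζ hζ => by rw [hqe]; exact hdet ζ hζ
  let f : ℂ → ℂ := fun ζ => p.eval ζ / q.eval ζ
  -- the solution vector
  have hsol : ∀ ζ ∈ SDom, ∃ x, P *ᵥ x - ζ • (N *ᵥ x) = w ∧ f ζ = star w ⬝ᵥ x := by
    intro ζ hζ
    have hd := hdet ζ hζ
    let x := ((P + Q - ζ • N).det)⁻¹ • ((P + Q - ζ • N).adjugate *ᵥ w)
    have hx : (P + Q - ζ • N) *ᵥ x = w := by
      simp only [x]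
      rw [mulVec_smul, mulVec_mulVec, mul_adjugate, smul_mulVec, one_mulVec, smul_smul,
        inv_mul_cancel₀ hd, one_smul]
    refine ⟨x, ?_, ?_⟩
    · rw [sub_mulVec, smul_mulVec, add_mulVec] at hx
      have hQx : Q *ᵥ x = 0 := by
        rw [← dotProduct_star_self_eq_zero, dotProduct_comm]
        have hy : Q *ᵥ x = T *ᵥ (Tᴴ *ᵥ x) := by rw [hQ, mulVec_mulVec]
        set y := Q *ᵥ x with hydef
        have h1 : star y ⬝ᵥ w = 0 := by
          have := hperp y (by rw [hy]; exact hTN _) (by rw [hy]; exact hTP _)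
          have h2 := congrArg star this
          rw [star_dotProduct] at h2
          simpa using h2
        rw [← hx, dotProduct_sub, dotProduct_add, dotProduct_smul, herm_swap hP.1,
          herm_swap hN.1] at h1
        rw [hy, hTN, hTP, ← hy] at h1
        simpa using h1
      rw [hQx, add_zero] at hx
      exact hx
    · simp only [f, x, hpe, hqe, dotProduct_smul, smul_eq_mul]
      rw [div_eq_inv_mul]
  have hwd : ∀ ζ ∈ SDom, ∀ y, P *ᵥ y - ζ • (N *ᵥ y) = w → f ζ = star w ⬝ᵥ y := by
    intro ζ hζ y hy
    obtain ⟨x, hx, hfx⟩ := hsol ζ hζ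
    have h1 : P *ᵥ (x - y) = ζ • (N *ᵥ (x - y)) := by
      rw [mulVec_sub, mulVec_sub, smul_sub, sub_eq_sub_iff_sub_eq_sub, hx, hy]
    obtain ⟨h2, h3⟩ := psd_pencil hP hN hζ h1
    have := hperp _ h3 h2
    rw [dotProduct_sub, sub_eq_zero] at this
    rw [hfx, this]
  have hform : ∀ ζ ∈ SDom, ∃ (x : Fin n → ℂ) (a b : ℝ), P *ᵥ x - ζ • (N *ᵥ x) = w ∧ 0 ≤ a ∧ 0 ≤ b ∧
      (b = 0 → N *ᵥ x = 0) ∧ f ζ = a - conj ζ * b := by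
    intro ζ hζ
    obtain ⟨x, hx, hfx⟩ := hsol ζ hζ
    obtain ⟨a, ha, hax⟩ := psd_real hP x
    obtain ⟨b, hb, hbx⟩ := psd_real hN x
    refine ⟨x, a, b, hx, ha, hb, ?_, ?_⟩
    · intro h; rw [← hN.dotProduct_mulVec_zero_iff, hbx, h]; simp
    · rw [hfx]
      have : star x ⬝ᵥ w = a - ζ * b := by
        nth_rewrite 1 [← hx]
        rw [dotProduct_sub, dotProduct_smul, hax, hbx, smul_eq_mul]
      have h2 := congrArg star this
      rw [star_dotProduct, star_star] at h2
      rw [h2]; simp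
  refine ⟨f, ⟨?_, ?_⟩, ?_, p, q, ?_, fun ζ _ => rfl⟩
  · intro ζ hζ
    have h1 : AnalyticAt ℂ (fun ζ => p.eval ζ) ζ :=
      (Differentiable.analyticAt (Polynomial.differentiable p) ζ)
    have h2 : AnalyticAt ℂ (fun ζ => q.eval ζ) ζ :=
      (Differentiable.analyticAt (Polynomial.differentiable q) ζ)
    exact h1.div h2 (hq0 ζ hζ)
  · by_cases hcst : ∃ x, P *ᵥ x = w ∧ N *ᵥ x = 0
    · left
      obtain ⟨x, hPx, hNx⟩ := hcst
      obtain ⟨a, ha, hax⟩ := psd_real hP x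
      refine ⟨a, ha, fun ζ hζ => ?_⟩
      rw [hwd ζ hζ x (by rw [hPx, hNx]; simp), ← hPx, ← herm_swap hP.1, hax]
    · right
      have hbpos : ∀ ζ ∈ SDom, ∃ a b : ℝ, 0 ≤ a ∧ 0 < b ∧ f ζ = a - conj ζ * b := by
        intro ζ hζ
        obtain ⟨x, a, b, hx, ha, hb, hb0, hf⟩ := hform ζ hζ
        refine ⟨a, b, ha, lt_of_le_of_ne hb fun h => hcst ⟨x, ?_, hb0 h.symm⟩, hf⟩
        rw [hb0 h.symm] at hx
        simpa using hx
      refine ⟨fun ζ hζ => ?_, fun r hr => ?_, fun ζ hζ => ?_⟩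
      · obtain ⟨a, b, ha, hb, hf⟩ := hbpos ζ (sdom_of_im hζ)
        rw [hf]; simp; positivity
      · have hm : (r : ℂ) ∈ SDom := by
          intro h; have := h.1; rw [Complex.ofReal_re] at this; linarith
        obtain ⟨a, b, ha, hb, hf⟩ := hbpos r hm
        refine ⟨a - r * b, ?_, ?_⟩
        · nlinarith
        · rw [hf]; simp
      · have hζ' : conj ζ ∈ SDom := by
          intro h; apply hζ; simpa using h
        obtain ⟨x, hx, hfx⟩ := hsol ζ hζ
        obtain ⟨y, hy, hfy⟩ := hsol _ hζ'
        rw [hfx, hfy]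
        have h1 : conj (star w ⬝ᵥ x) = star x ⬝ᵥ w := by
          rw [← star_def, star_dotProduct, star_star]
        rw [h1]
        nth_rewrite 1 [← hy]
        nth_rewrite 1 [← hx]
        rw [dotProduct_sub, dotProduct_smul, herm_swap hP.1, herm_swap hN.1, star_sub, star_smul,
          sub_dotProduct, smul_dotProduct]
        rfl
  · intro j
    obtain ⟨x, hx, hfx⟩ := hsol (z j) (sdom_of_im (hz j))
    have := congrFun hx j
    simp only [Pi.sub_apply, Pi.smul_apply, smul_eq_mul, hrow] at this
    rw [hfx, ← this]; ring
  · intro h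
    apply hq0 (-1) (by intro h; have := h.1; norm_num at this)
    rw [h]; simp

theorem statement4 (n : ℕ) (z w : Fin n → ℂ)
    (hz : ∀ j, 0 < (z j).im) (hinj : Function.Injective z)
    (hN : (NPmatN n z w).PosSemidef) (hP : (NPmatP n z w).PosSemidef)
    (hsing : (NPmatN n z w).det = 0 ∨ (NPmatP n z w).det = 0) :
    ∃ f : ℂ → ℂ,
      (StieltjesClass f ∧ (∀ j, f (z j) = w j) ∧
        ∃ p q : Polynomial ℂ, q ≠ 0 ∧ ∀ ζ ∈ SDom, f ζ = p.eval ζ / q.eval ζ) ∧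
      ∀ g : ℂ → ℂ, StieltjesClass g → (∀ j, g (z j) = w j) → ∀ ζ ∈ SDom, g ζ = f ζ := by
  have hne : ∀ j k, z j - conj (z k) ≠ 0 := by
    intro j k h
    have := congrArg Complex.im h
    simp at this
    linarith [hz j, hz k]
  obtain ⟨f, hf, hfw, hrat⟩ := existence_core n z w (NPmatN n z w) (NPmatP n z w) hN hP hz (by
    intro j k
    simp only [NPmatN, NPmatP, Matrix.of_apply, map_mul]
    have := hne j k
    field_simp
    ring)
  exact ⟨f, ⟨hf, hfw, hrat⟩, fun g hg hgw =>
    stieltjes_unique hf hg z w hz hinj hfw hgw hsing⟩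
end
end
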